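/- arXiv:2306.16841 — 2 statements merged into one kernel-verified Lean document; each statement's English description precedes it below -/
import Mathlib

section
/- Let (T^s, ν^s) and (T^u, ν^u) be measurable pseudo-Anosov turbulations on Σ, and let ℓ_s and ℓ_u be any stable and unstable streamlines. Then ℓ_s ∩ ℓ_u is dense in Σ. -/
open MeasureTheory Set Function Topology Filter
open scoped ENNReal

noncomputable section

variable {S : Type} [TopologicalSpace S] [MeasurableSpace S]

/-- `d` is (the distance function of) a metric on `S` compatible with its topology. -/
def IsCompatibleMetric (S : Type) [TopologicalSpace S] (d : S → S → ℝ) : Prop :=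
  (∀ x y, d x y = d y x) ∧ (∀ x y, d x y = 0 ↔ x = y) ∧
  (∀ x y z, d x z ≤ d x y + d y z) ∧
  (∀ s : Set S, IsOpen s ↔ ∀ x ∈ s, ∃ ε > (0 : ℝ), ∀ y, d x y < ε → y ∈ s)

/-- An immersed line: a continuous injective image of `ℝ`. -/
def IsImmersedLine (ℓ : Set S) : Prop :=
  ∃ f : ℝ → S, Continuous f ∧ Function.Injective f ∧ Set.range f = ℓ

/-- `A` is a closed stream arc of the immersed line `ℓ` with endpoints `x` and `y`. -/
def IsArcIn (ℓ A : Set S) (x y : S) : Prop :=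
  ∃ f : ℝ → S, Continuous f ∧ Function.Injective f ∧ Set.range f = ℓ ∧
    ∃ a b : ℝ, a ≤ b ∧ f a = x ∧ f b = y ∧ A = f '' Set.Icc a b

/-- `A` is a closed stream arc of the immersed line `ℓ`. -/
def IsArc (ℓ A : Set S) : Prop := ∃ x y, IsArcIn ℓ A x y

/-- Topological transversality of two immersed lines at a point `x`: local pieces (arcs) of the
two lines through `x` are, in some chart around `x`, the two coordinate axes. -/
def TransverseAt (ℓ ℓ' : Set S) (x : S) : Prop :=
  ∃ α β : Set S, x ∈ α ∧ x ∈ β ∧ IsArc ℓ α ∧ IsArc ℓ' β ∧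
    ∃ U : Set S, IsOpen U ∧ x ∈ U ∧ ∃ e : U ≃ₜ ℝ × ℝ,
      Subtype.val '' (⇑e ⁻¹' {p : ℝ × ℝ | p.2 = 0}) = α ∩ U ∧
      Subtype.val '' (⇑e ⁻¹' {p : ℝ × ℝ | p.1 = 0}) = β ∩ U

/-- The (manifold) boundary of the surface `S`: points having no neighbourhood
homeomorphic to the plane. -/
def ManifoldBdry (S : Type) [TopologicalSpace S] : Set S :=
  {x : S | ¬ ∃ U : Set S, IsOpen U ∧ x ∈ U ∧ Nonempty (U ≃ₜ ℝ × ℝ)}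

/-- An Oxtoby–Ulam (OU) measure on the compact surface `S`: Borel (via the ambient
`BorelSpace` assumption), non-atomic, positive on non-empty open sets, and vanishing on
the boundary of `S`. -/
structure IsOUMeasure (μ : Measure S) : Prop where
  noAtoms : ∀ x : S, μ {x} = 0
  openPos : ∀ U : Set S, IsOpen U → U.Nonempty → 0 < μ U
  boundaryNull : μ (ManifoldBdry S) = 0

/-- A measured turbulation on `S` (with ambient measure `μ`): a partition of a full
`μ`-measure Borel subset of `S` into streamlines (immersed lines), together with an
OU measure on each streamline which is finite on closed stream arcs. -/
structure MeasuredTurbulation (μ : Measure S) where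
  lines : Set (Set S)
  lines_immersed : ∀ ℓ ∈ lines, IsImmersedLine ℓ
  lines_disjoint : lines.PairwiseDisjoint id
  domain_borel : MeasurableSet (⋃₀ lines)
  domain_full : μ (⋃₀ lines) = 1
  ν : Set S → Measure S
  ν_supported : ∀ ℓ ∈ lines, ν ℓ ℓᶜ = 0
  ν_nonatomic : ∀ ℓ ∈ lines, ∀ x : S, ν ℓ {x} = 0
  ν_arc_pos : ∀ ℓ ∈ lines, ∀ A : Set S, ∀ x y : S, IsArcIn ℓ A x y → x ≠ y → 0 < ν ℓ A
  ν_arc_finite : ∀ ℓ ∈ lines, ∀ A : Set S, ∀ x y : S, IsArcIn ℓ A x y → ν ℓ A < ⊤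

namespace MeasuredTurbulation

variable {μ : Measure S}

/-- Tameness with respect to a given metric `d`: stream arcs of small stream measure are small. -/
def TameWith (T : MeasuredTurbulation μ) (d : S → S → ℝ) : Prop :=
  ∀ ε : ℝ, 0 < ε → ∃ δ : ℝ, 0 < δ ∧
    ∀ ℓ ∈ T.lines, ∀ A : Set S, ∀ x y : S,
      IsArcIn ℓ A x y → T.ν ℓ A < ENNReal.ofReal δ → d x y < ε

/-- A measured turbulation is tame if it is tame with respect to (every, equivalently some)
metric on `S` compatible with its topology. -/
def Tame (T : MeasuredTurbulation μ) : Prop :=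
  ∀ d : S → S → ℝ, IsCompatibleMetric S d → T.TameWith d

/-- Every streamline is dense in `S`. -/
def DenseStreamlines (T : MeasuredTurbulation μ) : Prop := ∀ ℓ ∈ T.lines, Dense ℓ

/-- Two measured turbulations are transverse if almost every point lies on streamlines of both
which intersect transversely there. -/
def TransversePair (Ts Tu : MeasuredTurbulation μ) : Prop :=
  ∃ W : Set S, MeasurableSet W ∧ μ W = 1 ∧
    ∀ x ∈ W, ∃ ℓ ∈ Ts.lines, ∃ ℓ' ∈ Tu.lines, x ∈ ℓ ∧ x ∈ ℓ' ∧ TransverseAt ℓ ℓ' x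

end MeasuredTurbulation

/-- A tartan for the (stable, unstable) pair of measured turbulations `(Ts, Tu)`. -/
structure Tartan {μ : Measure S} (Ts Tu : MeasuredTurbulation μ) where
  Rs : Set S
  Ru : Set S
  borel_s : MeasurableSet Rs
  borel_u : MeasurableSet Ru
  fibs : Set (Set S)
  fibu : Set (Set S)
  fibs_disjoint : fibs.PairwiseDisjoint id
  fibu_disjoint : fibu.PairwiseDisjoint id
  fibs_cover : ⋃₀ fibs = Rs
  fibu_cover : ⋃₀ fibu = Ru
  /-- (a) every stable fiber meets every unstable fiber in exactly one point. -/
  inter_unique : ∀ A ∈ fibs, ∀ B ∈ fibu, ∃! z : S, z ∈ A ∩ B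
  /-- The fibers are stream arcs of the corresponding turbulations, and (b) they can be
  oriented consistently: every stable fiber crosses the unstable fibers in the same order,
  and vice versa. -/
  oriented : ∃ ords ordu : Set S → S → S → Prop,
    (∀ A ∈ fibs, ∃ ℓ ∈ Ts.lines, ∃ f : ℝ → S, Continuous f ∧ Function.Injective f ∧
        Set.range f = ℓ ∧ ∃ a b : ℝ, a ≤ b ∧ A = f '' Set.Icc a b ∧
        ∀ s ∈ Set.Icc a b, ∀ t ∈ Set.Icc a b, (ords A (f s) (f t) ↔ s ≤ t)) ∧
    (∀ B ∈ fibu, ∃ ℓ ∈ Tu.lines, ∃ f : ℝ → S, Continuous f ∧ Function.Injective f ∧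
        Set.range f = ℓ ∧ ∃ a b : ℝ, a ≤ b ∧ B = f '' Set.Icc a b ∧
        ∀ s ∈ Set.Icc a b, ∀ t ∈ Set.Icc a b, (ordu B (f s) (f t) ↔ s ≤ t)) ∧
    (∀ A ∈ fibs, ∀ A' ∈ fibs, ∀ B ∈ fibu, ∀ B' ∈ fibu,
      ∀ p ∈ A ∩ B, ∀ q ∈ A ∩ B', ∀ p' ∈ A' ∩ B, ∀ q' ∈ A' ∩ B',
        (ords A p q ↔ ords A' p' q')) ∧
    (∀ B ∈ fibu, ∀ B' ∈ fibu, ∀ A ∈ fibs, ∀ A' ∈ fibs,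
      ∀ p ∈ B ∩ A, ∀ q ∈ B ∩ A', ∀ p' ∈ B' ∩ A, ∀ q' ∈ B' ∩ A',
        (ordu B p q ↔ ordu B' p' q'))
  /-- (c) the stream measures of the fibers are bounded above. -/
  bounded : ∃ L : ℝ≥0∞, L < ⊤ ∧
    (∀ A ∈ fibs, ∀ ℓ ∈ Ts.lines, A ⊆ ℓ → Ts.ν ℓ A ≤ L) ∧
    (∀ B ∈ fibu, ∀ ℓ ∈ Tu.lines, B ⊆ ℓ → Tu.ν ℓ B ≤ L)
  /-- (d) `Rs ∪ Ru` is contained in an open topological disk. -/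
  in_disk : ∃ U : Set S, IsOpen U ∧ Rs ∪ Ru ⊆ U ∧ Nonempty (U ≃ₜ ℝ × ℝ)

namespace Tartan

variable {μ : Measure S} {Ts Tu : MeasuredTurbulation μ}

/-- The set `R^⋔` of tartan intersection points. -/
def core (R : Tartan Ts Tu) : Set S := R.Rs ∩ R.Ru

/-- The tartan `R` is compatible with the ambient measure `μ`: for all stable and unstable
fibers `𝔰`, `𝔲`, the bijection `ψ : E^𝔰 × E^𝔲 → R^⋔`, `(x, y) ↦ 𝔲(x) ⋔ 𝔰(y)`, is
bi-measurable and pushes `ν_𝔰 × ν_𝔲` forward to `μ` restricted to `R^⋔`. -/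
def Compatible (R : Tartan Ts Tu) : Prop :=
  ∀ 𝔰 ∈ R.fibs, ∀ 𝔲 ∈ R.fibu,
  ∀ ℓs ∈ Ts.lines, 𝔰 ⊆ ℓs → ∀ ℓu ∈ Tu.lines, 𝔲 ⊆ ℓu →
  ∃ ψ : S × S → S,
    (∀ x ∈ 𝔰 ∩ R.core, ∀ y ∈ 𝔲 ∩ R.core,
      ∀ B ∈ R.fibu, x ∈ B → ∀ A ∈ R.fibs, y ∈ A → ψ (x, y) ∈ B ∩ A) ∧
    Set.InjOn ψ ((𝔰 ∩ R.core) ×ˢ (𝔲 ∩ R.core)) ∧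
    ψ '' ((𝔰 ∩ R.core) ×ˢ (𝔲 ∩ R.core)) = R.core ∧
    Measurable ψ ∧
    (∀ E : Set (S × S), E ⊆ (𝔰 ∩ R.core) ×ˢ (𝔲 ∩ R.core) → MeasurableSet E →
      MeasurableSet (ψ '' E)) ∧
    Measure.map ψ (((Ts.ν ℓs).restrict (𝔰 ∩ R.core)).prod
      ((Tu.ν ℓu).restrict (𝔲 ∩ R.core))) = μ.restrict R.core

/-- Image of `B ⊆ E^𝔰` under the holonomy map `h_{𝔰,𝔰'} : E^𝔰 → E^{𝔰'}`, `x ↦ 𝔲(x) ⋔ 𝔰'`. -/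
def holSS (R : Tartan Ts Tu) (𝔰' B : Set S) : Set S :=
  {x' : S | ∃ x ∈ B, ∃ Bu ∈ R.fibu, x ∈ Bu ∧ x' ∈ Bu ∩ 𝔰'}

/-- Image of `B ⊆ E^𝔲` under the holonomy map `h_{𝔲,𝔲'} : E^𝔲 → E^{𝔲'}`, `y ↦ 𝔰(y) ⋔ 𝔲'`. -/
def holUU (R : Tartan Ts Tu) (𝔲' B : Set S) : Set S :=
  {y' : S | ∃ y ∈ B, ∃ A ∈ R.fibs, y ∈ A ∧ y' ∈ A ∩ 𝔲'}

/-- "`𝔲(x) ⋔ 𝔰(y) ∈ A`": the intersection point of the unstable fiber through `x` and the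
stable fiber through `y` belongs to `A`. -/
def sectMem (R : Tartan Ts Tu) (A : Set S) (x y : S) : Prop :=
  ∃ B ∈ R.fibu, x ∈ B ∧ ∃ C ∈ R.fibs, y ∈ C ∧ ∃ z ∈ B ∩ C, z ∈ A

/-- `ν_{𝔲(x)}(A ∩ 𝔲(x))`: the stream measure of `A` along the unstable fiber through `x`. -/
def fiberMeasU (R : Tartan Ts Tu) (A : Set S) (x : S) : ℝ≥0∞ :=
  ⨆ (B : Set S) (_ : B ∈ R.fibu) (_ : x ∈ B) (ℓ : Set S) (_ : ℓ ∈ Tu.lines) (_ : B ⊆ ℓ),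
    Tu.ν ℓ (A ∩ B)

/-- `ν_{𝔰(y)}(A ∩ 𝔰(y))`: the stream measure of `A` along the stable fiber through `y`. -/
def fiberMeasS (R : Tartan Ts Tu) (A : Set S) (y : S) : ℝ≥0∞ :=
  ⨆ (C : Set S) (_ : C ∈ R.fibs) (_ : y ∈ C) (ℓ : Set S) (_ : ℓ ∈ Ts.lines) (_ : C ⊆ ℓ),
    Ts.ν ℓ (A ∩ C)

end Tartan

/-- The union of the stable streamlines containing fibers of `R`. -/
def stableSaturation {μ : Measure S} {Ts Tu : MeasuredTurbulation μ} (R : Tartan Ts Tu) :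
    Set S :=
  ⋃₀ {ℓ : Set S | ℓ ∈ Ts.lines ∧ ∃ A ∈ R.fibs, A ⊆ ℓ}

/-- The union of the unstable streamlines containing fibers of `R`. -/
def unstableSaturation {μ : Measure S} {Ts Tu : MeasuredTurbulation μ} (R : Tartan Ts Tu) :
    Set S :=
  ⋃₀ {ℓ : Set S | ℓ ∈ Tu.lines ∧ ∃ B ∈ R.fibu, B ⊆ ℓ}

/-- The pair `(Ts, Tu)` is full: countably many compatible tartans cover a full measure
subset of `S`, and every non-empty open set contains a positive measure compatible tartan. -/
def FullPair {μ : Measure S} (Ts Tu : MeasuredTurbulation μ) : Prop :=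
  (∃ R : ℕ → Tartan Ts Tu, (∀ i, (R i).Compatible) ∧ μ (⋃ i, (R i).core) = 1) ∧
  (∀ U : Set S, IsOpen U → U.Nonempty →
    ∃ R : Tartan Ts Tu, R.Compatible ∧ 0 < μ R.core ∧ R.Rs ∪ R.Ru ⊆ U)

/-- `(Ts, Tu)` are measurable pseudo-Anosov turbulations: transverse, tame, full, with
dense streamlines. -/
def MPATurbulations {μ : Measure S} (Ts Tu : MeasuredTurbulation μ) : Prop :=
  Ts.TransversePair Tu ∧ Ts.Tame ∧ Tu.Tame ∧ FullPair Ts Tu ∧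
    Ts.DenseStreamlines ∧ Tu.DenseStreamlines

/-- `F` is a measurable pseudo-Anosov homeomorphism with invariant turbulations `(Ts, Tu)`
and dilatation `lam > 1`. -/
structure IsMPA (μ : Measure S) (F : S ≃ₜ S) (Ts Tu : MeasuredTurbulation μ)
    (lam : ℝ) : Prop where
  measurePreserving : MeasurePreserving (⇑F) μ μ
  one_lt_lam : 1 < lam
  turbulations : MPATurbulations Ts Tu
  stable_image : ∀ ℓ ∈ Ts.lines, ⇑F '' ℓ ∈ Ts.lines
  unstable_image : ∀ ℓ ∈ Tu.lines, ⇑F '' ℓ ∈ Tu.lines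
  stable_contract : ∀ ℓ ∈ Ts.lines, ∀ A : Set S, ∀ x y : S, IsArcIn ℓ A x y →
    Ts.ν (⇑F '' ℓ) (⇑F '' A) = (ENNReal.ofReal lam)⁻¹ * Ts.ν ℓ A
  unstable_expand : ∀ ℓ ∈ Tu.lines, ∀ A : Set S, ∀ x y : S, IsArcIn ℓ A x y →
    Tu.ν (⇑F '' ℓ) (⇑F '' A) = ENNReal.ofReal lam * Tu.ν ℓ A

/-- `x` is a (two-sided) density point of `D` along the streamline `ℓ` of `T`. -/
def DensityPtAlong {μ : Measure S} (T : MeasuredTurbulation μ) (ℓ D : Set S) (x : S) :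
    Prop :=
  ∀ ε : ℝ, 0 < ε → ∃ δ : ℝ, 0 < δ ∧ ∀ A : Set S, ∀ y : S,
    IsArcIn ℓ A x y → T.ν ℓ A < ENNReal.ofReal δ →
      (1 - ε) * (T.ν ℓ A).toReal ≤ (T.ν ℓ (A ∩ D)).toReal

/-- The set `den_k(R)` of level `k` density points of the tartan `R`. -/
def denSet {μ : Measure S} {Ts Tu : MeasuredTurbulation μ} (R : Tartan Ts Tu) :
    ℕ → Set S
  | 0 => R.core
  | k + 1 =>
    {x : S | x ∈ denSet R k ∧
      (∀ ℓ ∈ Ts.lines, x ∈ ℓ → DensityPtAlong Ts ℓ (denSet R k) x) ∧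
      (∀ ℓ ∈ Tu.lines, x ∈ ℓ → DensityPtAlong Tu ℓ (denSet R k) x)}

/-- The set `X_{δ,η}(R)`: points of `R^⋔` all of whose stable and unstable stream arcs of
measure less than `η` contain points of `R^⋔` in density at least `1 - δ`. -/
def Xset {μ : Measure S} {Ts Tu : MeasuredTurbulation μ} (R : Tartan Ts Tu)
    (δ η : ℝ) : Set S :=
  {x : S | x ∈ R.core ∧
    (∀ ℓ ∈ Ts.lines, x ∈ ℓ → ∀ A : Set S, ∀ y : S, IsArcIn ℓ A x y →
      Ts.ν ℓ A < ENNReal.ofReal η →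
        ENNReal.ofReal (1 - δ) * Ts.ν ℓ A ≤ Ts.ν ℓ (A ∩ R.core)) ∧
    (∀ ℓ ∈ Tu.lines, x ∈ ℓ → ∀ A : Set S, ∀ y : S, IsArcIn ℓ A x y →
      Tu.ν ℓ A < ENNReal.ofReal η →
        ENNReal.ofReal (1 - δ) * Tu.ν ℓ A ≤ Tu.ν ℓ (A ∩ R.core))}

/-- A regular tartan: for `y ∈ 𝔰(x) ∩ R^⋔` and `z ∈ 𝔲(x) ∩ R^⋔` at small stream distance
from `x`, all the fibers of the subtartan `R(y,z)` (the subarcs of stable fibers running from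
`𝔲(y)` to `𝔲(z) = 𝔲(x)`, and of unstable fibers running from `𝔰(y) = 𝔰(x)` to `𝔰(z)`)
are contained in `U`. -/
def Tartan.Regular {μ : Measure S} {Ts Tu : MeasuredTurbulation μ}
    (R : Tartan Ts Tu) : Prop :=
  ∀ x ∈ R.core, ∀ U ∈ 𝓝 x, ∃ δ : ℝ, 0 < δ ∧
    ∀ 𝔰x ∈ R.fibs, x ∈ 𝔰x → ∀ 𝔲x ∈ R.fibu, x ∈ 𝔲x →
    ∀ y ∈ 𝔰x ∩ R.core, ∀ z ∈ 𝔲x ∩ R.core,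
    (∀ ℓ ∈ Ts.lines, 𝔰x ⊆ ℓ → ∀ α : Set S, IsArcIn ℓ α x y →
      Ts.ν ℓ α < ENNReal.ofReal δ) →
    (∀ ℓ ∈ Tu.lines, 𝔲x ⊆ ℓ → ∀ α : Set S, IsArcIn ℓ α x z →
      Tu.ν ℓ α < ENNReal.ofReal δ) →
    ∀ 𝔲y ∈ R.fibu, y ∈ 𝔲y → ∀ 𝔰z ∈ R.fibs, z ∈ 𝔰z →
      ((∀ A ∈ R.fibs, ∀ p q : S, p ∈ A ∩ 𝔲y → q ∈ A ∩ 𝔲x →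
          ∀ ℓ ∈ Ts.lines, A ⊆ ℓ → ∀ α : Set S, IsArcIn ℓ α p q → α ⊆ U) ∧
       (∀ B ∈ R.fibu, ∀ p q : S, p ∈ B ∩ 𝔰x → q ∈ B ∩ 𝔰z →
          ∀ ℓ ∈ Tu.lines, B ⊆ ℓ → ∀ β : Set S, IsArcIn ℓ β p q → β ⊆ U))

/-- A (stable) bi-Lipschitz regular tartan: for some metric compatible with the topology of
`S` and some `K ≥ 1`, stream measure and distance are `K`-bi-Lipschitz comparable along
stable fibers. -/
def Tartan.StableBiLipschitzRegular {μ : Measure S} {Ts Tu : MeasuredTurbulation μ}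
    (R : Tartan Ts Tu) : Prop :=
  ∃ d : S → S → ℝ, IsCompatibleMetric S d ∧ ∃ K : ℝ, 1 ≤ K ∧
    ∀ 𝔰 ∈ R.fibs, ∀ x ∈ 𝔰, ∀ y ∈ 𝔰, ∀ ℓ ∈ Ts.lines, 𝔰 ⊆ ℓ →
      ∀ α : Set S, IsArcIn ℓ α x y →
        d x y / K ≤ (Ts.ν ℓ α).toReal ∧ (Ts.ν ℓ α).toReal ≤ K * d x y

/-- The turbulation `T` has partial flowboxes: if `x` and `y` lie on the same streamline
`ℓ`, and arcs transverse to `ℓ` at `x` and `y` contain transverse intersections with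
streamlines of `T` arbitrarily close to `x` and `y` on the same side of `ℓ`, then every
neighbourhood `U` of the stream arc `[x,y]` contains other stream arcs with endpoints on the
two transversals.  (The transversals and the side are encoded via a chart straightening the
streamline.) -/
def HasPartialFlowboxes {μ : Measure S} (T : MeasuredTurbulation μ) : Prop :=
  ∀ ℓ ∈ T.lines, ∀ x y : S, ∀ A : Set S, IsArcIn ℓ A x y →
  ∀ V : Set S, IsOpen V → ∀ e : V ≃ₜ ℝ × ℝ, A ⊆ V →
  (Subtype.val '' (⇑e ⁻¹' {p : ℝ × ℝ | p.2 = 0}) ⊆ ℓ) →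
  (∃ hx : x ∈ V, e ⟨x, hx⟩ = (0, 0)) →
  (∃ hy : y ∈ V, e ⟨y, hy⟩ = (1, 0)) →
  (∀ ε : ℝ, 0 < ε → ∃ p : S, ∃ hp : p ∈ V,
      (e ⟨p, hp⟩).1 = 0 ∧ 0 < (e ⟨p, hp⟩).2 ∧ (e ⟨p, hp⟩).2 < ε ∧
      ∃ ℓ' ∈ T.lines, p ∈ ℓ' ∧
        TransverseAt ℓ' (Subtype.val '' (⇑e ⁻¹' {q : ℝ × ℝ | q.1 = 0})) p) →
  (∀ ε : ℝ, 0 < ε → ∃ p : S, ∃ hp : p ∈ V,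
      (e ⟨p, hp⟩).1 = 1 ∧ 0 < (e ⟨p, hp⟩).2 ∧ (e ⟨p, hp⟩).2 < ε ∧
      ∃ ℓ' ∈ T.lines, p ∈ ℓ' ∧
        TransverseAt ℓ' (Subtype.val '' (⇑e ⁻¹' {q : ℝ × ℝ | q.1 = 1})) p) →
  ∀ U : Set S, IsOpen U → A ⊆ U →
    ∃ ℓ'' ∈ T.lines, ∃ A'' : Set S, ∃ x'' y'' : S, IsArcIn ℓ'' A'' x'' y'' ∧
      A'' ⊆ U ∧ A'' ≠ A ∧
      x'' ∈ Subtype.val '' (⇑e ⁻¹' {q : ℝ × ℝ | q.1 = 0}) ∧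
      y'' ∈ Subtype.val '' (⇑e ⁻¹' {q : ℝ × ℝ | q.1 = 1})

/-- Forward Birkhoff averages of `φ` under the homeomorphism `F`. -/
def birkhoffFwd (F : S ≃ₜ S) (φ : S → ℝ) (x : S) (n : ℕ) : ℝ :=
  (n : ℝ)⁻¹ * ∑ i ∈ Finset.range n, φ ((⇑F)^[i] x)

/-- Backward Birkhoff averages of `φ` under the homeomorphism `F`. -/
def birkhoffBwd (F : S ≃ₜ S) (φ : S → ℝ) (x : S) (n : ℕ) : ℝ :=
  (n : ℝ)⁻¹ * ∑ i ∈ Finset.range n, φ ((⇑F.symm)^[i] x)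

/-- The set `Z` of points where the forward and backward Birkhoff averages of `φ` exist
and are equal. -/
def ZSet (F : S ≃ₜ S) (φ : S → ℝ) : Set S :=
  {x : S | ∃ c : ℝ, Tendsto (birkhoffFwd F φ x) atTop (𝓝 c) ∧
      Tendsto (birkhoffBwd F φ x) atTop (𝓝 c)}

/-- The relation `~` on `Z`: `x ~ y` if they are joined by a finite chain of stream arcs
whose consecutive intersections contain points of `Z`. -/
def StreamRel {μ : Measure S} (Ts Tu : MeasuredTurbulation μ) (F : S ≃ₜ S)
    (φ : S → ℝ) (x y : S) : Prop :=
  x ∈ ZSet F φ ∧ y ∈ ZSet F φ ∧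
  (x = y ∨ ∃ k : ℕ, ∃ α : Fin (k + 1) → Set S,
    (∀ i, (∃ ℓ ∈ Ts.lines, IsArc ℓ (α i)) ∨ (∃ ℓ ∈ Tu.lines, IsArc ℓ (α i))) ∧
    x ∈ α 0 ∧ y ∈ α (Fin.last k) ∧
    ∀ i : Fin k, ∃ z ∈ α i.castSucc ∩ α i.succ, z ∈ ZSet F φ)

/-- A nowhere vanishing continuous function on a simply connected space has a logarithm. -/
theorem exists_continuous_log {A : Type*} [TopologicalSpace A] [SimplyConnectedSpace A]
    [LocallyPathConnectedSpace A] (g : A → ℂ) (hg : Continuous g) (h0 : ∀ a, g a ≠ 0) :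
    ∃ L : A → ℂ, Continuous L ∧ ∀ a, Complex.exp (L a) = g a := by
  obtain ⟨a₀⟩ : Nonempty A := inferInstance
  obtain ⟨F, ⟨-, hF⟩, -⟩ := Complex.isCoveringMapOn_exp.existsUnique_continuousMap_lifts
    (f := ⟨g, hg⟩) (a₀ := a₀) (e₀ := Complex.log (g a₀))
    (by simpa using Complex.exp_log (h0 a₀)) (fun a => by simpa using h0 a)
  exact ⟨F, F.continuous, fun a => congrFun hF a⟩

theorem exists_int_winding (g : ℝ → ℂ) {A₀ A₁ : ℂ} (h₀ : Complex.exp A₀ = g 0)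
    (h₁ : Complex.exp A₁ = g 1) :
    ∃ n : ℤ, ∀ L : ℝ → ℂ, Continuous L → (∀ t, Complex.exp (L t) = g t) →
      L 1 - L 0 = A₁ - A₀ + 2 * Real.pi * Complex.I * n := by
  by_cases hL : ∃ L : ℝ → ℂ, Continuous L ∧ ∀ t, Complex.exp (L t) = g t
  · obtain ⟨L, hLc, hL⟩ := hL
    obtain ⟨n₁, hn₁⟩ := Complex.exp_eq_exp_iff_exists_int.1 ((hL 1).trans h₁.symm)
    obtain ⟨n₀, hn₀⟩ := Complex.exp_eq_exp_iff_exists_int.1 ((hL 0).trans h₀.symm)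
    refine ⟨n₁ - n₀, fun L' hLc' hL' => ?_⟩
    have key : ∀ t, ∃ n : ℤ, L' t - L t = n * (2 * Real.pi * Complex.I) := fun t => by
      obtain ⟨n, hn⟩ := Complex.exp_eq_exp_iff_exists_int.1 ((hL' t).trans (hL t).symm)
      exact ⟨n, by rw [hn]; ring⟩
    choose m hm using key
    have hpi : (2 * Real.pi * Complex.I : ℂ) ≠ 0 := Complex.two_pi_I_ne_zero
    have hmc : Continuous fun t => (m t : ℝ) := by
      have : (fun t => (m t : ℝ)) = fun t => ((L' t - L t) / (2 * Real.pi * Complex.I)).re := by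
        ext t
        rw [hm t, mul_div_cancel_right₀ _ hpi]
        simp
      rw [this]
      fun_prop
    have hmc' : Continuous m := Int.isClosedEmbedding_coe_real.isInducing.continuous_iff.2 hmc
    have h01 : m 1 = m 0 := isPreconnected_univ.constant hmc'.continuousOn (mem_univ _) (mem_univ _)
    have e1 := hm 1
    have e0 := hm 0
    rw [h01] at e1
    push_cast
    linear_combination e1 - e0 + hn₁ - hn₀
  · exact ⟨0, fun L h1 h2 => (hL ⟨L, h1, h2⟩).elim⟩

/-- The complete graph on five vertices cannot be drawn in the plane so that any two edges
without a common endpoint are disjoint. -/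
theorem not_planar_K5 (p : Fin 5 → ℂ) (E : Fin 5 → Fin 5 → Set ℂ)
    (hE : ∀ v w, v < w → JoinedIn (E v w) (p v) (p w))
    (hd : ∀ v w x y, v < w → x < y → v ≠ x → v ≠ y → w ≠ x → w ≠ y →
      Disjoint (E v w) (E x y)) : False := by
  have hpath : ∀ v w, ∃ e : ℝ → ℂ, v < w →
      Continuous e ∧ e 0 = p v ∧ e 1 = p w ∧ ∀ t, e t ∈ E v w := by
    intro v w
    by_cases h : v < w
    · obtain ⟨γ, hγ⟩ := hE v w h
      refine ⟨γ.extend, fun _ => ⟨γ.continuous_extend, γ.extend_zero, γ.extend_one, fun t => ?_⟩⟩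
      exact hγ _
    · exact ⟨0, fun h' => (h h').elim⟩
  choose e he using hpath
  have hc := fun v w h => (he v w h).1
  have hs := fun v w h => (he v w h).2.1
  have ht := fun v w h => (he v w h).2.2.1
  have hm := fun v w h => (he v w h).2.2.2
  have hpl : ∀ v w, v < w → p v ∈ E v w := fun v w h => hs v w h ▸ hm v w h 0
  have hpr : ∀ v w, v < w → p w ∈ E v w := fun v w h => ht v w h ▸ hm v w h 1
  have hpm : ∀ v x, v ≠ x → (v < x ∧ p v ∈ E v x) ∨ (x < v ∧ p v ∈ E x v) := fun v x h =>
    h.lt_or_gt.imp (fun h => ⟨h, hpl _ _ h⟩) (fun h => ⟨h, hpr _ _ h⟩)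
  have hne : ∀ v w, v ≠ w → p v ≠ p w := by
    intro v w hvw heq
    obtain ⟨x, y, h1, h2, h3, h4, h5⟩ : ∃ x y : Fin 5, v ≠ x ∧ w ≠ y ∧ v ≠ y ∧ x ≠ w ∧ x ≠ y := by
      clear * - hvw; revert v w; decide
    rcases hpm v x h1 with ⟨a, b⟩ | ⟨a, b⟩ <;> rcases hpm w y h2 with ⟨c, d⟩ | ⟨c, d⟩ <;>
      refine disjoint_left.1 (hd _ _ _ _ a c ?_ ?_ ?_ ?_) b (heq ▸ d) <;>
      assumption
  let A : Fin 5 → Fin 5 → ℂ := fun v w =>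
    if v < w then Complex.log (p w - p v) else Complex.log (p v - p w) + Real.pi * Complex.I
  have hA : ∀ v w, v ≠ w → Complex.exp (A v w) = p w - p v := by
    intro v w h
    by_cases hvw : v < w
    · simp only [A, if_pos hvw]
      exact Complex.exp_log (sub_ne_zero.2 (hne _ _ h.symm))
    · simp only [A, if_neg hvw, Complex.exp_add, Complex.exp_pi_mul_I]
      rw [Complex.exp_log (sub_ne_zero.2 (hne _ _ h))]
      ring
  let ε : Fin 5 → Fin 5 → ℤ := fun x y => if x < y then -1 else 1
  have hAε : ∀ v w, v ≠ w → A v w - A w v = Real.pi * Complex.I * ε v w := by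
    intro v w h
    rcases h.lt_or_gt with h | h
    · simp [A, ε, h, h.not_gt]
    · simp [A, ε, h, h.not_gt]
  have hW : ∀ v a b : Fin 5, ∃ n : ℤ, a < b → v ≠ a → v ≠ b → ∀ L : ℝ → ℂ, Continuous L →
      (∀ t, Complex.exp (L t) = e a b t - p v) →
      L 1 - L 0 = A v b - A v a + 2 * Real.pi * Complex.I * n := by
    intro v a b
    by_cases h : a < b ∧ v ≠ a ∧ v ≠ b
    · obtain ⟨n, hn⟩ := exists_int_winding (fun t => e a b t - p v) (A₀ := A v a) (A₁ := A v b)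
        (by rw [hA _ _ h.2.1, hs _ _ h.1]) (by rw [hA _ _ h.2.2, ht _ _ h.1])
      exact ⟨n, fun _ _ _ => hn⟩
    · exact ⟨0, fun h1 h2 h3 => (h ⟨h1, h2, h3⟩).elim⟩
  choose n hn using hW
  have main : ∀ a b c d : Fin 5, a < b → c < d → a ≠ c → a ≠ d → b ≠ c → b ≠ d →
      2 * (n c a b + n b c d - n a c d - n d a b) = -(ε c b + ε b d + ε d a + ε a c) := by
    intro a b c d hab hcd hac had hbc hbd
    obtain ⟨L, hLc, hL⟩ := exists_continuous_log (fun q : ℝ × ℝ => e a b q.1 - e c d q.2)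
      (((hc _ _ hab).comp continuous_fst).sub ((hc _ _ hcd).comp continuous_snd))
      (fun q => sub_ne_zero.2 fun h => disjoint_left.1 (hd _ _ _ _ hab hcd hac had hbc hbd)
        (hm _ _ hab q.1) (h ▸ hm _ _ hcd q.2))
    have e1 := hn c a b hab hac.symm hbc.symm (fun s => L (s, 0)) (by fun_prop)
      (fun t => by rw [hL]; simp [hs _ _ hcd])
    have e2 := hn d a b hab had.symm hbd.symm (fun s => L (s, 1)) (by fun_prop)
      (fun t => by rw [hL]; simp [ht _ _ hcd])
    have e3 := hn b c d hcd hbc hbd (fun s => L (1, s) - Real.pi * Complex.I) (by fun_prop)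
      (fun t => by rw [Complex.exp_sub, hL, Complex.exp_pi_mul_I, ht _ _ hab]; ring)
    have e4 := hn a c d hcd hac had (fun s => L (0, s) - Real.pi * Complex.I) (by fun_prop)
      (fun t => by rw [Complex.exp_sub, hL, Complex.exp_pi_mul_I, hs _ _ hab]; ring)
    have f1 := hAε c b hbc.symm
    have f2 := hAε b d hbd
    have f3 := hAε d a had.symm
    have f4 := hAε a c hac
    have hpi : (Real.pi * Complex.I : ℂ) ≠ 0 := by simp [Real.pi_ne_zero]
    have : (Real.pi * Complex.I : ℂ) * (2 * (n c a b + n b c d - n a c d - n d a b)) =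
        Real.pi * Complex.I * (-(ε c b + ε b d + ε d a + ε a c)) := by
      linear_combination e2 + e4 - e1 - e3 - f1 - f2 - f3 - f4
    exact_mod_cast mul_left_cancel₀ hpi this
  have m1 := main 0 1 2 3 (by decide) (by decide) (by decide) (by decide) (by decide) (by decide)
  have m2 := main 0 1 2 4 (by decide) (by decide) (by decide) (by decide) (by decide) (by decide)
  have m3 := main 0 1 3 4 (by decide) (by decide) (by decide) (by decide) (by decide) (by decide)
  have m4 := main 0 2 1 3 (by decide) (by decide) (by decide) (by decide) (by decide) (by decide)
  have m5 := main 0 2 1 4 (by decide) (by decide) (by decide) (by decide) (by decide) (by decide)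
  have m6 := main 0 2 3 4 (by decide) (by decide) (by decide) (by decide) (by decide) (by decide)
  have m7 := main 0 3 1 2 (by decide) (by decide) (by decide) (by decide) (by decide) (by decide)
  have m8 := main 0 3 1 4 (by decide) (by decide) (by decide) (by decide) (by decide) (by decide)
  have m9 := main 0 3 2 4 (by decide) (by decide) (by decide) (by decide) (by decide) (by decide)
  have m10 := main 0 4 1 2 (by decide) (by decide) (by decide) (by decide) (by decide) (by decide)
  have m11 := main 0 4 1 3 (by decide) (by decide) (by decide) (by decide) (by decide) (by decide)
  have m12 := main 0 4 2 3 (by decide) (by decide) (by decide) (by decide) (by decide) (by decide)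
  have m13 := main 1 2 3 4 (by decide) (by decide) (by decide) (by decide) (by decide) (by decide)
  have m14 := main 1 3 2 4 (by decide) (by decide) (by decide) (by decide) (by decide) (by decide)
  have m15 := main 1 4 2 3 (by decide) (by decide) (by decide) (by decide) (by decide) (by decide)
  simp [ε] at m1 m2 m3 m4 m5 m6 m7 m8 m9 m10 m11 m12 m13 m14 m15
  omega

/-- A form of the nonplanarity of the complete graph for edges that are finite unions of
pieces whose disjointness is certified by a relation. -/
theorem not_planar_K5_pieces {P : Type*} (s : P → Set ℂ) (d : P → P → Prop)
    (hd : ∀ a b, d a b → Disjoint (s a) (s b)) {p₀ p₁ p₂ p₃ p₄ : ℂ}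
    {E₀₁ E₀₂ E₀₃ E₀₄ E₁₂ E₁₃ E₁₄ E₂₃ E₂₄ E₃₄ : List P}
    (j₀₁ : JoinedIn (⋃ x ∈ E₀₁, s x) p₀ p₁) (j₀₂ : JoinedIn (⋃ x ∈ E₀₂, s x) p₀ p₂)
    (j₀₃ : JoinedIn (⋃ x ∈ E₀₃, s x) p₀ p₃) (j₀₄ : JoinedIn (⋃ x ∈ E₀₄, s x) p₀ p₄)
    (j₁₂ : JoinedIn (⋃ x ∈ E₁₂, s x) p₁ p₂) (j₁₃ : JoinedIn (⋃ x ∈ E₁₃, s x) p₁ p₃)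
    (j₁₄ : JoinedIn (⋃ x ∈ E₁₄, s x) p₁ p₄) (j₂₃ : JoinedIn (⋃ x ∈ E₂₃, s x) p₂ p₃)
    (j₂₄ : JoinedIn (⋃ x ∈ E₂₄, s x) p₂ p₄) (j₃₄ : JoinedIn (⋃ x ∈ E₃₄, s x) p₃ p₄)
    (h₁ : ∀ a ∈ E₀₁, (∀ b ∈ E₂₃, d a b) ∧ (∀ b ∈ E₂₄, d a b) ∧ ∀ b ∈ E₃₄, d a b)
    (h₂ : ∀ a ∈ E₀₂, (∀ b ∈ E₁₃, d a b) ∧ (∀ b ∈ E₁₄, d a b) ∧ ∀ b ∈ E₃₄, d a b)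
    (h₃ : ∀ a ∈ E₀₃, (∀ b ∈ E₁₂, d a b) ∧ (∀ b ∈ E₁₄, d a b) ∧ ∀ b ∈ E₂₄, d a b)
    (h₄ : ∀ a ∈ E₀₄, (∀ b ∈ E₁₂, d a b) ∧ (∀ b ∈ E₁₃, d a b) ∧ ∀ b ∈ E₂₃, d a b)
    (h₅ : ∀ a ∈ E₁₂, ∀ b ∈ E₃₄, d a b) (h₆ : ∀ a ∈ E₁₃, ∀ b ∈ E₂₄, d a b)
    (h₇ : ∀ a ∈ E₁₄, ∀ b ∈ E₂₃, d a b) : False := by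
  have key : ∀ {l l' : List P}, (∀ a ∈ l, ∀ b ∈ l', d a b) →
      Disjoint (⋃ x ∈ l, s x) (⋃ x ∈ l', s x) := by
    intro l l' h
    simp only [disjoint_iUnion_left, disjoint_iUnion_right]
    exact fun a ha b hb => hd _ _ (h b hb a ha)
  have k₁ := key fun a ha => (h₁ a ha).1
  have k₂ := key fun a ha => (h₁ a ha).2.1
  have k₃ := key fun a ha => (h₁ a ha).2.2
  have k₄ := key fun a ha => (h₂ a ha).1
  have k₅ := key fun a ha => (h₂ a ha).2.1
  have k₆ := key fun a ha => (h₂ a ha).2.2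
  have k₇ := key fun a ha => (h₃ a ha).1
  have k₈ := key fun a ha => (h₃ a ha).2.1
  have k₉ := key fun a ha => (h₃ a ha).2.2
  have k₁₀ := key fun a ha => (h₄ a ha).1
  have k₁₁ := key fun a ha => (h₄ a ha).2.1
  have k₁₂ := key fun a ha => (h₄ a ha).2.2
  have k₁₃ := key h₅
  have k₁₄ := key h₆
  have k₁₅ := key h₇
  refine not_planar_K5 ![p₀, p₁, p₂, p₃, p₄]
    ![![∅, ⋃ x ∈ E₀₁, s x, ⋃ x ∈ E₀₂, s x, ⋃ x ∈ E₀₃, s x, ⋃ x ∈ E₀₄, s x],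
      ![∅, ∅, ⋃ x ∈ E₁₂, s x, ⋃ x ∈ E₁₃, s x, ⋃ x ∈ E₁₄, s x],
      ![∅, ∅, ∅, ⋃ x ∈ E₂₃, s x, ⋃ x ∈ E₂₄, s x],
      ![∅, ∅, ∅, ∅, ⋃ x ∈ E₃₄, s x], ![∅, ∅, ∅, ∅, ∅]] ?_ ?_
  · intro v w h
    fin_cases v <;> fin_cases w <;> first | exact absurd h (by decide) | assumption
  · intro v w x y h h' h1 h2 h3 h4
    fin_cases v <;> fin_cases w <;> first
      | exact absurd h (by decide)
      | (fin_cases x <;> fin_cases y <;> first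
          | exact absurd h' (by decide)
          | exact absurd rfl h1
          | exact absurd rfl h2
          | exact absurd rfl h3
          | exact absurd rfl h4
          | assumption
          | (apply Disjoint.symm; assumption))

/-- `k` lies between `a` and `b`. -/
def Betw {ι : Type*} [LinearOrder ι] (a b k : ι) : Prop := (a ≤ k ∧ k ≤ b) ∨ (b ≤ k ∧ k ≤ a)

instance {ι : Type*} [LinearOrder ι] (a b k : ι) : Decidable (Betw a b k) :=
  inferInstanceAs (Decidable (_ ∨ _))

theorem betw_left {ι : Type*} [LinearOrder ι] (a b : ι) : Betw a b a :=
  (le_total a b).imp (fun h => ⟨le_rfl, h⟩) fun h => ⟨h, le_rfl⟩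

theorem betw_right {ι : Type*} [LinearOrder ι] (a b : ι) : Betw a b b :=
  (le_total a b).imp (fun h => ⟨h, le_rfl⟩) fun h => ⟨le_rfl, h⟩

theorem Betw.symm {ι : Type*} [LinearOrder ι] {a b k : ι} (h : Betw a b k) : Betw b a k := Or.symm h

/-- Maps preserving and reflecting betweenness. -/
structure BetwMap {ι ι' : Type*} [LinearOrder ι] [LinearOrder ι'] (f : ι → ι') : Prop where
  inj : Injective f
  iff : ∀ a b k, Betw (f a) (f b) (f k) ↔ Betw a b k

theorem StrictMono.betwMap {ι ι' : Type*} [LinearOrder ι] [LinearOrder ι'] {f : ι → ι'}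
    (hf : StrictMono f) : BetwMap f :=
  ⟨hf.injective, fun a b k => by simp only [Betw, hf.le_iff_le]⟩

theorem StrictAnti.betwMap {ι ι' : Type*} [LinearOrder ι] [LinearOrder ι'] {f : ι → ι'}
    (hf : StrictAnti f) : BetwMap f :=
  ⟨hf.injective, fun a b k => by simp only [Betw, hf.le_iff_ge]; tauto⟩

/-- A topological grid in the plane: pairwise disjoint rows and pairwise disjoint columns,
such that every row crosses every column exactly once. The arc of the row `j` between the
columns `a` and `b` is `S j a b`, and similarly for columns. -/
structure Grid (ι κ : Type*) [LinearOrder ι] [LinearOrder κ] where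
  z : ι → κ → ℂ
  S : κ → ι → ι → Set ℂ
  U : ι → κ → κ → Set ℂ
  z_mem_S : ∀ {a b k} j, Betw a b k → z k j ∈ S j a b
  z_mem_U : ∀ {a b k} i, Betw a b k → z i k ∈ U i a b
  conn_S : ∀ j a b, IsPathConnected (S j a b)
  conn_U : ∀ i a b, IsPathConnected (U i a b)
  closed_S : ∀ j a b, IsClosed (S j a b)
  closed_U : ∀ i a b, IsClosed (U i a b)
  mono_S : ∀ {a b k k'} j, Betw a b k → Betw a b k' → S j k k' ⊆ S j a b
  mono_U : ∀ {a b k k'} i, Betw a b k → Betw a b k' → U i k k' ⊆ U i a b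
  disj_S : ∀ {j j'} a b a' b', j ≠ j' → Disjoint (S j a b) (S j' a' b')
  disj_U : ∀ {i i'} a b a' b', i ≠ i' → Disjoint (U i a b) (U i' a' b')
  disj_SU : ∀ {a b l l' i j}, ¬(Betw a b i ∧ Betw l l' j) → Disjoint (S j a b) (U i l l')

namespace Grid

variable {ι κ ι' κ' : Type*} [LinearOrder ι] [LinearOrder κ] [LinearOrder ι'] [LinearOrder κ']

/-- Interchange of rows and columns. -/
def swap (G : Grid ι κ) : Grid κ ι where
  z i j := G.z j i
  S := G.U
  U := G.S
  z_mem_S := G.z_mem_U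
  z_mem_U := G.z_mem_S
  conn_S := G.conn_U
  conn_U := G.conn_S
  closed_S := G.closed_U
  closed_U := G.closed_S
  mono_S := G.mono_U
  mono_U := G.mono_S
  disj_S := G.disj_U
  disj_U := G.disj_S
  disj_SU h := (G.disj_SU fun h' => h h'.symm).symm

/-- Selection of rows and columns. -/
def comap (G : Grid ι κ) {f : ι' → ι} {g : κ' → κ} (hf : BetwMap f) (hg : BetwMap g) :
    Grid ι' κ' where
  z i j := G.z (f i) (g j)
  S j a b := G.S (g j) (f a) (f b)
  U i a b := G.U (f i) (g a) (g b)
  z_mem_S _ h := G.z_mem_S _ ((hf.iff _ _ _).2 h)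
  z_mem_U _ h := G.z_mem_U _ ((hg.iff _ _ _).2 h)
  conn_S _ _ _ := G.conn_S _ _ _
  conn_U _ _ _ := G.conn_U _ _ _
  closed_S _ _ _ := G.closed_S _ _ _
  closed_U _ _ _ := G.closed_U _ _ _
  mono_S _ h h' := G.mono_S _ ((hf.iff _ _ _).2 h) ((hf.iff _ _ _).2 h')
  mono_U _ h h' := G.mono_U _ ((hg.iff _ _ _).2 h) ((hg.iff _ _ _).2 h')
  disj_S _ _ _ _ h := G.disj_S _ _ _ _ (hg.inj.ne h)
  disj_U _ _ _ _ h := G.disj_U _ _ _ _ (hf.inj.ne h)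
  disj_SU h := G.disj_SU fun h' => h ⟨(hf.iff _ _ _).1 h'.1, (hg.iff _ _ _).1 h'.2⟩

theorem S_comm (G : Grid ι κ) (j : κ) (a b : ι) : G.S j a b = G.S j b a :=
  (G.mono_S j (betw_right _ _) (betw_left _ _)).antisymm (G.mono_S j (betw_right _ _) (betw_left _ _))

theorem U_comm (G : Grid ι κ) (i : ι) (a b : κ) : G.U i a b = G.U i b a := G.swap.S_comm i a b

/-- The boundary of a rectangle of the grid. -/
def frame (G : Grid ι κ) (c c' : ι) (r r' : κ) : Set ℂ :=
  G.S r c c' ∪ G.S r' c c' ∪ (G.U c r r' ∪ G.U c' r r')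

theorem frame_comm_left (G : Grid ι κ) (c c' : ι) (r r' : κ) :
    G.frame c c' r r' = G.frame c' c r r' := by
  rw [frame, frame, G.S_comm r, G.S_comm r', union_comm (G.U c r r')]

theorem frame_comm_right (G : Grid ι κ) (c c' : ι) (r r' : κ) :
    G.frame c c' r r' = G.frame c c' r' r := by
  rw [frame, frame, G.U_comm c, G.U_comm c', union_comm (G.S r c c')]

theorem swap_frame (G : Grid ι κ) (c c' : ι) (r r' : κ) :
    G.swap.frame r r' c c' = G.frame c c' r r' :=
  union_comm _ _

theorem isClosed_frame (G : Grid ι κ) (c c' : ι) (r r' : κ) : IsClosed (G.frame c c' r r') :=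
  ((G.closed_S _ _ _).union (G.closed_S _ _ _)).union
    ((G.closed_U _ _ _).union (G.closed_U _ _ _))

/-- Codes for arcs of rows, arcs of columns, and additional sets indexed by `X`. -/
abbrev Piece (ι κ X : Type*) := (κ × ι × ι) ⊕ (ι × κ × κ) ⊕ X

/-- The set with a given code. -/
def set (G : Grid ι κ) {X : Type*} (T : X → Set ℂ) : Piece ι κ X → Set ℂ
  | .inl (j, a, b) => G.S j a b
  | .inr (.inl (i, a, b)) => G.U i a b
  | .inr (.inr x) => T x

/-- A sufficient condition for disjointness; the pieces which the additional set with index `x`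
avoids are listed in `L x`. -/
def PieceDisj {X : Type*} (L : X → List (Piece ι κ X)) : Piece ι κ X → Piece ι κ X → Prop
  | .inl (j, _, _), .inl (j', _, _) => j ≠ j'
  | .inr (.inl (i, _, _)), .inr (.inl (i', _, _)) => i ≠ i'
  | .inl (j, a, b), .inr (.inl (i, l, l')) => ¬(Betw a b i ∧ Betw l l' j)
  | .inr (.inl (i, l, l')), .inl (j, a, b) => ¬(Betw a b i ∧ Betw l l' j)
  | .inr (.inr x), p => p ∈ L x
  | .inl q, .inr (.inr x) => .inl q ∈ L x
  | .inr (.inl q), .inr (.inr x) => .inr (.inl q) ∈ L x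

instance {X : Type*} [DecidableEq X] : DecidableEq (Piece ι κ X) :=
  @instDecidableEqSum _ _ instDecidableEqProd (@instDecidableEqSum _ _ instDecidableEqProd _)

instance {X : Type*} [DecidableEq X] (L : X → List (Piece ι κ X)) :
    ∀ p q : Piece ι κ X, Decidable (PieceDisj L p q)
  | .inl (j, _, _), .inl (j', _, _) => inferInstanceAs (Decidable (j ≠ j'))
  | .inr (.inl (i, _, _)), .inr (.inl (i', _, _)) => inferInstanceAs (Decidable (i ≠ i'))
  | .inl (j, a, b), .inr (.inl (i, l, l')) =>
    inferInstanceAs (Decidable ¬(Betw a b i ∧ Betw l l' j))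
  | .inr (.inl (i, l, l')), .inl (j, a, b) =>
    inferInstanceAs (Decidable ¬(Betw a b i ∧ Betw l l' j))
  | .inr (.inr x), p =>
    @List.instDecidableMemOfLawfulBEq _ instBEqOfDecidableEq inferInstance p (L x)
  | .inl q, .inr (.inr x) =>
    @List.instDecidableMemOfLawfulBEq _ instBEqOfDecidableEq inferInstance (.inl q) (L x)
  | .inr (.inl q), .inr (.inr x) =>
    @List.instDecidableMemOfLawfulBEq _ instBEqOfDecidableEq inferInstance (.inr (.inl q)) (L x)

theorem disjoint_of_pieceDisj (G : Grid ι κ) {X : Type*} {T : X → Set ℂ}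
    {L : X → List (Piece ι κ X)} (hL : ∀ x, ∀ p ∈ L x, Disjoint (T x) (G.set T p)) :
    ∀ p q, PieceDisj L p q → Disjoint (G.set T p) (G.set T q) := by
  rintro (⟨j, a, b⟩ | ⟨i, a, b⟩ | x) (⟨j', a', b'⟩ | ⟨i', a', b'⟩ | x') h
  · exact G.disj_S _ _ _ _ h
  · exact G.disj_SU h
  · exact (hL _ _ h).symm
  · exact (G.disj_SU h).symm
  · exact G.disj_U _ _ _ _ h
  · exact (hL _ _ h).symm
  all_goals exact hL _ _ h

theorem joinedIn_cons {P : Type*} {s : P → Set ℂ} {p : P} {l : List P} {x y w : ℂ}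
    (h : JoinedIn (s p) x y) (h' : JoinedIn (⋃ q ∈ l, s q) y w) :
    JoinedIn (⋃ q ∈ p :: l, s q) x w := by
  refine (h.mono ?_).trans (h'.mono ?_)
  · exact subset_biUnion_of_mem (u := s) (List.mem_cons_self ..)
  · exact biUnion_subset_biUnion_left fun q hq => List.mem_cons_of_mem _ hq

theorem joinedIn_singleton {P : Type*} {s : P → Set ℂ} {p : P} {x y : ℂ}
    (h : JoinedIn (s p) x y) : JoinedIn (⋃ q ∈ [p], s q) x y :=
  h.mono (subset_biUnion_of_mem (u := s) (List.mem_cons_self ..))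

theorem joinedIn_S (G : Grid ι κ) {X : Type*} (T : X → Set ℂ) (j : κ) (a b k k' : ι)
    (h : Betw a b k) (h' : Betw a b k') :
    JoinedIn (G.set T (.inl (j, a, b))) (G.z k j) (G.z k' j) :=
  (G.conn_S j a b).joinedIn _ (G.z_mem_S j h) _ (G.z_mem_S j h')

theorem joinedIn_U (G : Grid ι κ) {X : Type*} (T : X → Set ℂ) (i : ι) (a b k k' : κ)
    (h : Betw a b k) (h' : Betw a b k') :
    JoinedIn (G.set T (.inr (.inl (i, a, b)))) (G.z i k) (G.z i k') :=
  (G.conn_U i a b).joinedIn _ (G.z_mem_U i h) _ (G.z_mem_U i h')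

theorem separation_local (G : Grid (Fin 3) (Fin 4)) {y : ℂ}
    (h : JoinedIn (G.frame 0 2 0 2)ᶜ (G.z 1 1) y) : y ∉ G.S 3 0 2 := by
  intro hy
  obtain ⟨γ, hγ⟩ := h
  let T : Unit → Set ℂ := fun _ => range γ
  let L : Unit → List (Piece (Fin 3) (Fin 4) Unit) := fun _ =>
    [.inl (2, 1, 2), .inl (2, 0, 1), .inr (.inl (2, 0, 2)), .inl (0, 0, 2), .inr (.inl (0, 0, 2))]
  have hT : Disjoint (range γ) (G.frame 0 2 0 2) := by
    rw [disjoint_left]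
    rintro _ ⟨t, rfl⟩
    exact hγ t
  have hL : ∀ x, ∀ p ∈ L x, Disjoint (T x) (G.set T p) := by
    intro x p hp
    refine hT.mono_right ?_
    simp only [L, List.mem_cons, List.not_mem_nil, or_false] at hp
    rcases hp with rfl | rfl | rfl | rfl | rfl
    · exact (G.mono_S _ (by decide) (by decide)).trans
        (subset_union_right.trans subset_union_left)
    · exact (G.mono_S _ (by decide) (by decide)).trans
        (subset_union_right.trans subset_union_left)
    · exact subset_union_right.trans subset_union_right
    · exact subset_union_left.trans subset_union_left
    · exact subset_union_left.trans subset_union_right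
  have hS := G.joinedIn_S T
  have hU := G.joinedIn_U T
  exact not_planar_K5_pieces (G.set T) (PieceDisj L) (G.disjoint_of_pieceDisj hL)
    (joinedIn_singleton <| hS 2 1 2 1 2 (by decide) (by decide))
    (joinedIn_singleton <| hS 2 0 1 1 0 (by decide) (by decide))
    (joinedIn_singleton <| hU 1 1 2 2 1 (by decide) (by decide))
    (joinedIn_singleton <| hU 1 2 3 2 3 (by decide) (by decide))
    (joinedIn_cons (hU 2 0 2 2 0 (by decide) (by decide)) <|
      joinedIn_cons (hS 0 0 2 2 0 (by decide) (by decide)) <|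
      joinedIn_singleton (hU 0 0 2 0 2 (by decide) (by decide)))
    (joinedIn_cons (hU 2 1 2 2 1 (by decide) (by decide)) <|
      joinedIn_singleton (hS 1 1 2 2 1 (by decide) (by decide)))
    (joinedIn_cons (hU 2 2 3 2 3 (by decide) (by decide)) <|
      joinedIn_singleton (hS 3 0 2 2 1 (by decide) (by decide)))
    (joinedIn_cons (hU 0 1 2 2 1 (by decide) (by decide)) <|
      joinedIn_singleton (hS 1 0 1 0 1 (by decide) (by decide)))
    (joinedIn_cons (hU 0 2 3 2 3 (by decide) (by decide)) <|
      joinedIn_singleton (hS 3 0 2 0 1 (by decide) (by decide)))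
    (joinedIn_cons (p := .inr (.inr ())) (y := y) ⟨γ, fun t => mem_range_self t⟩ <|
      joinedIn_singleton (s := G.set T) (p := .inl (3, 0, 2)) <|
      (G.conn_S 3 0 2).joinedIn _ hy _ (G.z_mem_S 3 (by decide)))
    (by decide) (by decide) (by decide) (by decide) (by decide) (by decide) (by decide)

end Grid

namespace Grid

variable {ι κ ι' κ' : Type*} [LinearOrder ι] [LinearOrder κ] [LinearOrder ι'] [LinearOrder κ']

/-- The component of a central point inside of a frame. -/
def inner (G : Grid ι κ) (c c' : ι) (r r' : κ) (i : ι) (j : κ) : Set ℂ :=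
  pathComponentIn (G.frame c c' r r')ᶜ (G.z i j)

theorem swap_inner (G : Grid ι κ) (c c' : ι) (r r' : κ) (i : ι) (j : κ) :
    G.swap.inner r r' c c' j i = G.inner c c' r r' i j := by
  rw [inner, swap_frame]; rfl

theorem inner_comm_right (G : Grid ι κ) (c c' : ι) (r r' : κ) (i : ι) (j : κ) :
    G.inner c c' r r' i j = G.inner c c' r' r i j := by
  rw [inner, frame_comm_right]; rfl

theorem inner_comm_left (G : Grid ι κ) (c c' : ι) (r r' : κ) (i : ι) (j : κ) :
    G.inner c c' r r' i j = G.inner c' c r r' i j := by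
  rw [inner, frame_comm_left]; rfl

/-- A connected set outside of a frame does not meet its inner component. -/
theorem disjoint_inner_of_row (G : Grid ι κ) {c₀ c₁ c₂ : ι} {r₀ r₁ r₂ r₃ : κ} (hc₁ : c₀ < c₁)
    (hc₂ : c₁ < c₂) (hr₁ : r₀ < r₁) (hr₂ : r₁ < r₂) (hr₃ : r₃ < r₀ ∨ r₂ < r₃) {Q : Set ℂ}
    (hQ : IsPathConnected Q) (hd : Disjoint Q (G.frame c₀ c₂ r₀ r₂))
    (hm : (Q ∩ G.S r₃ c₀ c₂).Nonempty) : Disjoint Q (G.inner c₀ c₂ r₀ r₂ c₁ r₁) := by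
  rw [disjoint_left]
  intro x hxQ hx
  obtain ⟨y, hyQ, hy⟩ := hm
  have hxy : JoinedIn (G.frame c₀ c₂ r₀ r₂)ᶜ (G.z c₁ r₁) y :=
    JoinedIn.trans hx ((hQ.joinedIn _ hxQ _ hyQ).mono (subset_compl_iff_disjoint_right.2 hd))
  have hf : StrictMono ![c₀, c₁, c₂] := by
    rw [Fin.strictMono_iff_lt_succ]
    intro i; fin_cases i <;> assumption
  rcases hr₃ with hr₃ | hr₃
  · have hg : StrictAnti ![r₂, r₁, r₀, r₃] := by
      rw [Fin.strictAnti_iff_succ_lt]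
      intro i; fin_cases i <;> assumption
    rw [frame_comm_right] at hxy
    exact (G.comap hf.betwMap hg.betwMap).separation_local hxy hy
  · have hg : StrictMono ![r₀, r₁, r₂, r₃] := by
      rw [Fin.strictMono_iff_lt_succ]
      intro i; fin_cases i <;> assumption
    exact (G.comap hf.betwMap hg.betwMap).separation_local hxy hy

theorem disjoint_inner_of_col (G : Grid ι κ) {c₀ c₁ c₂ c₃ : ι} {r₀ r₁ r₂ : κ} (hc₁ : c₀ < c₁)
    (hc₂ : c₁ < c₂) (hr₁ : r₀ < r₁) (hr₂ : r₁ < r₂) (hc₃ : c₃ < c₀ ∨ c₂ < c₃) {Q : Set ℂ}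
    (hQ : IsPathConnected Q) (hd : Disjoint Q (G.frame c₀ c₂ r₀ r₂))
    (hm : (Q ∩ G.U c₃ r₀ r₂).Nonempty) : Disjoint Q (G.inner c₀ c₂ r₀ r₂ c₁ r₁) := by
  rw [← swap_inner]
  rw [← swap_frame] at hd
  exact G.swap.disjoint_inner_of_row hr₁ hr₂ hc₁ hc₂ hc₃ hQ hd hm

theorem disjoint_S_frame (G : Grid ι κ) {c c' : ι} {r r' : κ} {j : κ} {a b : ι} (h₁ : j ≠ r)
    (h₂ : j ≠ r') (h₃ : Betw a b c → ¬Betw r r' j) (h₄ : Betw a b c' → ¬Betw r r' j) :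
    Disjoint (G.S j a b) (G.frame c c' r r') := by
  simp only [frame, disjoint_union_right]
  exact ⟨⟨G.disj_S _ _ _ _ h₁, G.disj_S _ _ _ _ h₂⟩, G.disj_SU fun h => h₃ h.1 h.2,
    G.disj_SU fun h => h₄ h.1 h.2⟩

theorem disjoint_U_frame (G : Grid ι κ) {c c' : ι} {r r' : κ} {i : ι} {a b : κ} (h₁ : i ≠ c)
    (h₂ : i ≠ c') (h₃ : Betw a b r → ¬Betw c c' i) (h₄ : Betw a b r' → ¬Betw c c' i) :
    Disjoint (G.U i a b) (G.frame c c' r r') := by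
  rw [← swap_frame]
  exact G.swap.disjoint_S_frame h₁ h₂ h₃ h₄

theorem disjoint_S_inner_of_row (G : Grid ι κ) {c₀ c₁ c₂ a b : ι} {r₀ r₁ r₂ j : κ} (k : ι)
    (hc₁ : c₀ < c₁) (hc₂ : c₁ < c₂) (hr₁ : r₀ < r₁) (hr₂ : r₁ < r₂) (hj : j < r₀ ∨ r₂ < j)
    (hk : Betw a b k) (hk' : Betw c₀ c₂ k) : Disjoint (G.S j a b) (G.inner c₀ c₂ r₀ r₂ c₁ r₁) := by
  have hb : ¬Betw r₀ r₂ j := fun h => by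
    rcases h with h | h <;> rcases hj with hj | hj
    · exact hj.not_ge h.1
    · exact hj.not_ge h.2
    · exact (hr₁.trans hr₂).not_ge (h.1.trans h.2)
    · exact (hr₁.trans hr₂).not_ge (h.1.trans h.2)
  refine G.disjoint_inner_of_row hc₁ hc₂ hr₁ hr₂ hj (G.conn_S j a b)
    (G.disjoint_S_frame ?_ ?_ (fun _ => hb) fun _ => hb)
    ⟨G.z k j, G.z_mem_S j hk, G.z_mem_S j hk'⟩
  · rintro rfl; exact hb (betw_left _ _)
  · rintro rfl; exact hb (betw_right _ _)

theorem disjoint_U_inner_of_col (G : Grid ι κ) {c₀ c₁ c₂ i : ι} {r₀ r₁ r₂ a b : κ} (k : κ)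
    (hc₁ : c₀ < c₁) (hc₂ : c₁ < c₂) (hr₁ : r₀ < r₁) (hr₂ : r₁ < r₂) (hi : i < c₀ ∨ c₂ < i)
    (hk : Betw a b k) (hk' : Betw r₀ r₂ k) : Disjoint (G.U i a b) (G.inner c₀ c₂ r₀ r₂ c₁ r₁) := by
  rw [← swap_inner]
  exact G.swap.disjoint_S_inner_of_row k hr₁ hr₂ hc₁ hc₂ hi hk hk'

theorem disjoint_S_inner_of_col (G : Grid ι κ) {c₀ c₁ c₂ a b : ι} {r₀ r₁ r₂ j : κ} (k : ι)
    (hc₁ : c₀ < c₁) (hc₂ : c₁ < c₂) (hr₁ : r₀ < r₁) (hr₂ : r₁ < r₂) (hk' : k < c₀ ∨ c₂ < k)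
    (hk : Betw a b k) (hj : Betw r₀ r₂ j) (h₁ : j ≠ r₀) (h₂ : j ≠ r₂) (h₃ : ¬Betw a b c₀)
    (h₄ : ¬Betw a b c₂) : Disjoint (G.S j a b) (G.inner c₀ c₂ r₀ r₂ c₁ r₁) :=
  G.disjoint_inner_of_col hc₁ hc₂ hr₁ hr₂ hk' (G.conn_S j a b)
    (G.disjoint_S_frame h₁ h₂ (fun h => (h₃ h).elim) fun h => (h₄ h).elim)
    ⟨G.z k j, G.z_mem_S j hk, G.z_mem_U k hj⟩

theorem disjoint_U_inner_of_row (G : Grid ι κ) {c₀ c₁ c₂ i : ι} {r₀ r₁ r₂ a b : κ} (k : κ)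
    (hc₁ : c₀ < c₁) (hc₂ : c₁ < c₂) (hr₁ : r₀ < r₁) (hr₂ : r₁ < r₂) (hk' : k < r₀ ∨ r₂ < k)
    (hk : Betw a b k) (hi : Betw c₀ c₂ i) (h₁ : i ≠ c₀) (h₂ : i ≠ c₂) (h₃ : ¬Betw a b r₀)
    (h₄ : ¬Betw a b r₂) : Disjoint (G.U i a b) (G.inner c₀ c₂ r₀ r₂ c₁ r₁) := by
  rw [← swap_inner]
  exact G.swap.disjoint_S_inner_of_col k hr₁ hr₂ hc₁ hc₂ hk' hk hi h₁ h₂ h₃ h₄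

/-- Two transverse arms inside of crossing strips of a grid cannot be disjoint. -/
theorem crossing_local (G : Grid (Fin 7) (Fin 7)) {α β N N' X Y : Set ℂ}
    (hα : IsPathConnected α) (hαz : G.z 4 3 ∈ α) (hαm : (α ∩ G.U 0 2 4).Nonempty)
    (hαV : α ⊆ G.inner 0 5 2 4 4 3 ∪ G.U 0 2 4) (hαX : α ⊆ N ∪ X)
    (hβ : IsPathConnected β) (hβz : G.z 2 1 ∈ β) (hβm : (β ∩ G.S 5 1 3).Nonempty)
    (hβV : β ⊆ G.inner 1 3 0 5 2 1 ∪ G.S 5 1 3) (hβY : β ⊆ N' ∪ Y) (hXY : Disjoint X Y)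
    (hN : IsPathConnected N) (hNz : G.z 4 3 ∈ N) (hNd : Disjoint N (G.frame 1 3 0 5))
    (hN' : IsPathConnected N') (hNz' : G.z 2 1 ∈ N') (hNd' : Disjoint N' (G.frame 0 5 2 4)) :
    False := by
  have dα : ∀ {Q : Set ℂ}, Disjoint Q (G.inner 0 5 2 4 4 3) → Disjoint Q (G.U 0 2 4) →
      Disjoint α Q := fun h h' => (disjoint_union_right.2 ⟨h, h'⟩).symm.mono_left hαV
  have dβ : ∀ {Q : Set ℂ}, Disjoint Q (G.inner 1 3 0 5 2 1) → Disjoint Q (G.S 5 1 3) →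
      Disjoint β Q := fun h h' => (disjoint_union_right.2 ⟨h, h'⟩).symm.mono_left hβV
  have hNβ : Disjoint N β := by
    refine (disjoint_union_right.2 ⟨?_, hNd.mono_right ?_⟩).mono_right hβV
    · exact G.disjoint_inner_of_col (c₃ := 4) (by decide) (by decide) (by decide) (by decide)
        (by decide) hN hNd ⟨_, hNz, G.z_mem_U 4 (by decide)⟩
    · exact subset_union_right.trans subset_union_left
  have hNα : Disjoint N' α := by
    refine (disjoint_union_right.2 ⟨?_, hNd'.mono_right ?_⟩).mono_right hαV
    · exact G.disjoint_inner_of_row (r₃ := 1) (by decide) (by decide) (by decide) (by decide)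
        (by decide) hN' hNd' ⟨_, hNz', G.z_mem_S 1 (by decide)⟩
    · exact subset_union_left.trans subset_union_right
  have hαβ : Disjoint α β := by
    rw [disjoint_left]
    intro x hxα hxβ
    rcases hαX hxα with h | h
    · exact disjoint_left.1 hNβ h hxβ
    · rcases hβY hxβ with h' | h'
      · exact disjoint_left.1 hNα h' hxα
      · exact disjoint_left.1 hXY h h'
  let T : Bool → Set ℂ := fun x => cond x α β
  let L : Bool → List (Piece (Fin 7) (Fin 7) Bool) := fun x => cond x
    [.inl (5, 1, 3), .inr (.inl (2, 0, 1)), .inr (.inl (2, 5, 6)), .inl (6, 0, 6), .inl (0, 2, 6),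
      .inr (.inl (6, 0, 6)), .inr (.inr false)]
    [.inr (.inl (0, 2, 4)), .inr (.inl (0, 3, 6)), .inl (6, 0, 6), .inl (3, 4, 5), .inl (3, 5, 6),
      .inr (.inl (6, 3, 6)), .inr (.inr true)]
  have hL : ∀ x, ∀ p ∈ L x, Disjoint (T x) (G.set T p) := by
    rintro (_ | _) p hp <;> simp only [L, cond, List.mem_cons, List.not_mem_nil, or_false] at hp
    · rcases hp with rfl | rfl | rfl | rfl | rfl | rfl | rfl
      · refine dβ (G.disjoint_U_inner_of_col 3 ?_ ?_ ?_ ?_ ?_ ?_ ?_) (G.disj_SU ?_).symm <;> decide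
      · refine dβ (G.disjoint_U_inner_of_col 3 ?_ ?_ ?_ ?_ ?_ ?_ ?_) (G.disj_SU ?_).symm <;> decide
      · refine dβ (G.disjoint_S_inner_of_row 2 ?_ ?_ ?_ ?_ ?_ ?_ ?_) (G.disj_S _ _ _ _ ?_) <;>
          decide
      · refine dβ (G.disjoint_S_inner_of_col 4 ?_ ?_ ?_ ?_ ?_ ?_ ?_ ?_ ?_ ?_ ?_)
          (G.disj_S _ _ _ _ ?_) <;> decide
      · refine dβ (G.disjoint_S_inner_of_col 5 ?_ ?_ ?_ ?_ ?_ ?_ ?_ ?_ ?_ ?_ ?_)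
          (G.disj_S _ _ _ _ ?_) <;> decide
      · refine dβ (G.disjoint_U_inner_of_col 3 ?_ ?_ ?_ ?_ ?_ ?_ ?_) (G.disj_SU ?_).symm <;> decide
      · exact hαβ.symm
    · rcases hp with rfl | rfl | rfl | rfl | rfl | rfl | rfl
      · refine dα (G.disjoint_S_inner_of_row 1 ?_ ?_ ?_ ?_ ?_ ?_ ?_) (G.disj_SU ?_) <;> decide
      · refine dα (G.disjoint_U_inner_of_row 0 ?_ ?_ ?_ ?_ ?_ ?_ ?_ ?_ ?_ ?_ ?_)
          (G.disj_U _ _ _ _ ?_) <;> decide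
      · refine dα (G.disjoint_U_inner_of_row 5 ?_ ?_ ?_ ?_ ?_ ?_ ?_ ?_ ?_ ?_ ?_)
          (G.disj_U _ _ _ _ ?_) <;> decide
      · refine dα (G.disjoint_S_inner_of_row 1 ?_ ?_ ?_ ?_ ?_ ?_ ?_) (G.disj_SU ?_) <;> decide
      · refine dα (G.disjoint_S_inner_of_row 2 ?_ ?_ ?_ ?_ ?_ ?_ ?_) (G.disj_SU ?_) <;> decide
      · refine dα (G.disjoint_U_inner_of_col 3 ?_ ?_ ?_ ?_ ?_ ?_ ?_) (G.disj_U _ _ _ _ ?_) <;>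
          decide
      · exact hαβ
  obtain ⟨a, haα, haU⟩ := hαm
  obtain ⟨b, hbβ, hbS⟩ := hβm
  have jα : JoinedIn (G.set T (.inr (.inr true))) a (G.z 4 3) := hα.joinedIn _ haα _ hαz
  have jβ : JoinedIn (G.set T (.inr (.inr false))) b (G.z 2 1) := hβ.joinedIn _ hbβ _ hβz
  have ja : JoinedIn (G.set T (.inr (.inl (0, 2, 4)))) (G.z 0 3) a :=
    (G.conn_U 0 2 4).joinedIn _ (G.z_mem_U 0 (by decide)) _ haU
  have jb : JoinedIn (G.set T (.inl (5, 1, 3))) (G.z 2 5) b :=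
    (G.conn_S 5 1 3).joinedIn _ (G.z_mem_S 5 (by decide)) _ hbS
  have hS := G.joinedIn_S T
  have hU := G.joinedIn_U T
  exact not_planar_K5_pieces (G.set T) (PieceDisj L) (G.disjoint_of_pieceDisj hL)
    (joinedIn_cons (hU 0 3 5 3 5 (by decide) (by decide)) <|
      joinedIn_singleton (hS 5 0 2 0 2 (by decide) (by decide)))
    (joinedIn_cons ja <| joinedIn_cons jα <|
      joinedIn_singleton (hS 3 4 5 4 5 (by decide) (by decide)))
    (joinedIn_cons (hU 0 0 3 3 0 (by decide) (by decide)) <|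
      joinedIn_singleton (hS 0 0 2 0 2 (by decide) (by decide)))
    (joinedIn_cons (hU 0 3 6 3 6 (by decide) (by decide)) <|
      joinedIn_singleton (hS 6 0 6 0 6 (by decide) (by decide)))
    (joinedIn_cons (hS 5 2 5 2 5 (by decide) (by decide)) <|
      joinedIn_singleton (hU 5 3 5 5 3 (by decide) (by decide)))
    (joinedIn_cons jb <| joinedIn_cons jβ <|
      joinedIn_singleton (hU 2 0 1 1 0 (by decide) (by decide)))
    (joinedIn_cons (hU 2 5 6 5 6 (by decide) (by decide)) <|
      joinedIn_singleton (hS 6 0 6 2 6 (by decide) (by decide)))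
    (joinedIn_cons (hU 5 0 3 3 0 (by decide) (by decide)) <|
      joinedIn_singleton (hS 0 2 5 5 2 (by decide) (by decide)))
    (joinedIn_cons (hS 3 5 6 5 6 (by decide) (by decide)) <|
      joinedIn_singleton (hU 6 3 6 3 6 (by decide) (by decide)))
    (joinedIn_cons (hS 0 2 6 2 6 (by decide) (by decide)) <|
      joinedIn_singleton (hU 6 0 6 0 6 (by decide) (by decide)))
    (by decide) (by decide) (by decide) (by decide) (by decide) (by decide) (by decide)

end Grid

theorem isPathConnected_compl_ball (c : ℂ) (r : ℝ) :
    IsPathConnected (Metric.ball c r)ᶜ := by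
  have h : (Metric.ball c r)ᶜ =
      (fun p : ℝ × ℝ => c + p.1 * Complex.exp (p.2 * Complex.I)) '' (Ici r ×ˢ univ) := by
    ext x
    simp only [mem_compl_iff, Metric.mem_ball, not_lt, mem_image, mem_prod, mem_Ici, mem_univ,
      and_true, Prod.exists, dist_eq_norm]
    constructor
    · intro h
      exact ⟨‖x - c‖, (x - c).arg, h, by rw [Complex.norm_mul_exp_arg_mul_I]; ring⟩
    · rintro ⟨ρ, θ, h, rfl⟩
      simpa [Complex.norm_exp_ofReal_mul_I] using h.trans (le_abs_self ρ)
  rw [h]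
  have hc : Convex ℝ (Ici r ×ˢ (univ : Set ℝ)) := (convex_Ici r).prod convex_univ
  exact (hc.isPathConnected ⟨(r, 0), by simp⟩).image (by fun_prop)

namespace Grid

section

variable {ι κ : Type*} [LinearOrder ι] [LinearOrder κ]

theorem isPathConnected_frame (G : Grid ι κ) (c c' : ι) (r r' : κ) :
    IsPathConnected (G.frame c c' r r') := by
  have h₁ : IsPathConnected (G.S r c c' ∪ G.U c r r') :=
    (G.conn_S _ _ _).union (G.conn_U _ _ _)
      ⟨G.z c r, G.z_mem_S _ (betw_left _ _), G.z_mem_U _ (betw_left _ _)⟩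
  have h₂ : IsPathConnected (G.S r' c c' ∪ G.U c' r r') :=
    (G.conn_S _ _ _).union (G.conn_U _ _ _)
      ⟨G.z c' r', G.z_mem_S _ (betw_right _ _), G.z_mem_U _ (betw_right _ _)⟩
  have h := h₁.union h₂ ⟨G.z c r', .inr (G.z_mem_U _ (betw_right _ _)),
    .inl (G.z_mem_S _ (betw_left _ _))⟩
  rwa [union_union_union_comm] at h

theorem isPathConnected_inner (G : Grid ι κ) {c c' i : ι} {r r' j : κ}
    (h : G.z i j ∉ G.frame c c' r r') : IsPathConnected (G.inner c c' r r' i j) :=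
  isPathConnected_pathComponentIn h

theorem inner_congr_left (G : Grid ι κ) {c c' i i' : ι} {r r' j : κ} (hi : c < i) (hi' : i < c')
    (hk : c < i') (hk' : i' < c') (hj : r ≠ j) (hj' : j ≠ r') :
    G.inner c c' r r' i j = G.inner c c' r r' i' j := by
  refine pathComponentIn_congr (((G.conn_S j i i').joinedIn _ (G.z_mem_S _ (betw_right _ _)) _
    (G.z_mem_S _ (betw_left _ _))).mono (subset_compl_iff_disjoint_right.2
      (G.disjoint_S_frame hj.symm hj' (fun h => ?_) fun h => ?_)))
  · rcases h with h | h
    · exact (hi.not_ge h.1).elim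
    · exact (hk.not_ge h.1).elim
  · rcases h with h | h
    · exact (hk'.not_ge h.2).elim
    · exact (hi'.not_ge h.2).elim

theorem inner_congr_right (G : Grid ι κ) {c c' i : ι} {r r' j j' : κ} (hj : r < j) (hj' : j < r')
    (hk : r < j') (hk' : j' < r') (hi : c ≠ i) (hi' : i ≠ c') :
    G.inner c c' r r' i j = G.inner c c' r r' i j' := by
  rw [← swap_inner, ← G.swap_inner c c' r r' i j']
  exact G.swap.inner_congr_left hj hj' hk hk' hi hi'

theorem z_notMem_frame (G : Grid ι κ) {c c' i : ι} {r r' j : κ} (hi : c ≠ i) (hi' : i ≠ c')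
    (hj : r ≠ j) (hj' : j ≠ r') : G.z i j ∉ G.frame c c' r r' := by
  have h := G.disjoint_S_frame (a := i) (b := i) (c := c) (c' := c') hj.symm hj'
    (fun h => (hi (h.elim (fun h => h.2.antisymm h.1) fun h => h.2.antisymm h.1)).elim)
    (fun h => (hi' (h.elim (fun h => h.1.antisymm h.2) fun h => h.1.antisymm h.2)).elim)
  exact disjoint_left.1 h (G.z_mem_S j (betw_left _ _))

theorem z_mem_inner (G : Grid ι κ) {c c' i : ι} {r r' j : κ} (hi : c ≠ i) (hi' : i ≠ c')
    (hj : r ≠ j) (hj' : j ≠ r') : G.z i j ∈ G.inner c c' r r' i j :=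
  mem_pathComponentIn_self (G.z_notMem_frame hi hi' hj hj')

theorem frame_subset (G : Grid ι κ) {B : Set ℂ} (hS : ∀ j a b, G.S j a b ⊆ B)
    (hU : ∀ i a b, G.U i a b ⊆ B) (c c' : ι) (r r' : κ) : G.frame c c' r r' ⊆ B :=
  union_subset (union_subset (hS _ _ _) (hS _ _ _)) (union_subset (hU _ _ _) (hU _ _ _))

/-- Of two frames one outside of the other, at most one encloses the exterior of a disk. -/
theorem inner_subset_or (G : Grid ι κ) {B : Set ℂ} (hB : IsPathConnected Bᶜ)
    (hS : ∀ j a b, G.S j a b ⊆ B) (hU : ∀ i a b, G.U i a b ⊆ B) {c₀ c₁ c₂ d₀ d₁ d₂ : ι}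
    {r₀ r₁ r₂ s₀ s₁ s₂ : κ} (hc₁ : c₀ < c₁) (hc₂ : c₁ < c₂) (hd : c₂ < d₀) (hd₁ : d₀ < d₁)
    (hd₂ : d₁ < d₂) (hr₂ : r₁ < r₂) (hs₁ : s₀ < s₁) (hs₂ : s₁ < s₂)
    (h₁ : r₀ < s₀) (h₂ : s₀ < r₁) (h₃ : r₂ < s₂) :
    G.inner c₀ c₂ r₀ r₂ c₁ r₁ ⊆ B ∨ G.inner d₀ d₂ s₀ s₂ d₁ s₁ ⊆ B := by
  by_contra! h
  obtain ⟨x, hx, hxB⟩ := not_subset.1 h.1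
  obtain ⟨y, hy, hyB⟩ := not_subset.1 h.2
  have hr₁ := h₁.trans h₂
  have hrs := h₂.trans hr₂
  have hBd : Bᶜ ⊆ (G.frame d₀ d₂ s₀ s₂)ᶜ := compl_subset_compl.2 (G.frame_subset hS hU _ _ _ _)
  have hff : Disjoint (G.frame d₀ d₂ s₀ s₂) (G.frame c₀ c₂ r₀ r₂) := by
    have b₁ : ∀ k, d₀ ≤ k → ¬Betw c₀ c₂ k := fun k hk h => h.elim
      (fun h => (hd.trans_le (hk.trans h.2)).false)
      (fun h => (hc₁.trans hc₂).not_ge (h.1.trans h.2))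
    have b₂ : ∀ k, k ≤ c₂ → ¬Betw d₀ d₂ k := fun k hk h => h.elim
      (fun h => (hd.trans_le (h.1.trans hk)).false)
      (fun h => (hd₁.trans hd₂).not_ge (h.1.trans h.2))
    have hd₀ := (hc₁.trans hc₂).le
    have hd₃ := (hd₁.trans hd₂).le
    have key : ∀ s, s ≠ r₀ → s ≠ r₂ → Disjoint (G.S s d₀ d₂) (G.frame c₀ c₂ r₀ r₂) :=
      fun s h h' => G.disjoint_S_frame h h' (fun h => (b₂ _ hd₀ h).elim)
        fun h => (b₂ _ le_rfl h).elim
    refine disjoint_union_left.2 ⟨disjoint_union_left.2 ⟨key _ ?_ ?_, key _ ?_ ?_⟩,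
      disjoint_union_left.2 ⟨G.disjoint_U_frame ?_ ?_ (fun _ => b₁ _ le_rfl) fun _ => b₁ _ le_rfl,
        G.disjoint_U_frame ?_ ?_ (fun _ => b₁ _ hd₃) fun _ => b₁ _ hd₃⟩⟩
    · exact h₁.ne'
    · exact hrs.ne
    · exact (h₁.trans (hs₁.trans hs₂)).ne'
    · exact h₃.ne'
    · exact (hd₀.trans_lt hd).ne'
    · exact hd.ne'
    · exact ((hd₀.trans_lt hd).trans_le hd₃).ne'
    · exact (hd.trans_le hd₃).ne'
  have hP : IsPathConnected (G.inner c₀ c₂ r₀ r₂ c₁ r₁) :=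
    G.isPathConnected_inner (G.z_notMem_frame hc₁.ne hc₂.ne hr₁.ne hr₂.ne)
  have hPf : Disjoint (G.inner c₀ c₂ r₀ r₂ c₁ r₁) (G.frame d₀ d₂ s₀ s₂) :=
    (G.disjoint_inner_of_col hc₁ hc₂ hr₁ hr₂ (.inr hd) (G.isPathConnected_frame _ _ _ _) hff
      ⟨G.z d₀ s₀, .inl (.inl (G.z_mem_S _ (betw_left _ _))),
        G.z_mem_U _ (.inl ⟨h₁.le, hrs.le⟩)⟩).symm
  have hz := G.z_mem_inner hc₁.ne hc₂.ne hr₁.ne hr₂.ne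
  have hPd := G.disjoint_inner_of_col hd₁ hd₂ hs₁ hs₂ (.inl (hc₂.trans hd)) hP hPf
    ⟨G.z c₁ r₁, hz, G.z_mem_U _ (.inl ⟨h₂.le, (hr₂.trans h₃).le⟩)⟩
  refine disjoint_left.1 hPd hx ?_
  exact JoinedIn.trans hy ((hB.joinedIn _ hyB _ hxB).mono hBd)

/-- A frame inside of a bounded frame is bounded. -/
theorem inner_subset_of_inner_subset (G : Grid ι κ) {B : Set ℂ} {C c₀ c₁ c₂ C' : ι}
    {R r₀ r₁ r₂ R' : κ} (hC : C < c₀) (hc₁ : c₀ < c₁) (hc₂ : c₁ < c₂) (hC' : c₂ < C')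
    (hR : R < r₀) (hr₁ : r₀ < r₁) (hr₂ : r₁ < r₂) (hR' : r₂ < R')
    (hB : G.inner C C' R R' c₁ r₁ ⊆ B) : G.inner c₀ c₂ r₀ r₂ c₁ r₁ ⊆ B := by
  refine Subset.trans ?_ hB
  have hz : G.z c₁ r₁ ∉ G.frame c₀ c₂ r₀ r₂ := G.z_notMem_frame hc₁.ne hc₂.ne hr₁.ne hr₂.ne
  have hc := hc₁.trans hc₂
  have hr := hr₁.trans hr₂
  refine (G.isPathConnected_inner hz).subset_pathComponentIn (mem_pathComponentIn_self hz)
    (subset_compl_iff_disjoint_right.2 (Disjoint.symm ?_))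
  refine G.disjoint_inner_of_row hc₁ hc₂ hr₁ hr₂ (.inl hR) (G.isPathConnected_frame _ _ _ _) ?_
    ⟨G.z c₀ R, .inl (.inl (G.z_mem_S _ (.inl ⟨hC.le, (hc.trans hC').le⟩))),
      G.z_mem_S _ (betw_left _ _)⟩
  have b₁ : ∀ k, k < c₀ ∨ c₂ < k → ¬Betw c₀ c₂ k := by
    rintro k (hk | hk) (h | h)
    · exact hk.not_ge h.1
    · exact hc.not_ge (h.1.trans h.2)
    · exact hk.not_ge h.2
    · exact hc.not_ge (h.1.trans h.2)
  have b₂ : ∀ k, k < r₀ ∨ r₂ < k → ¬Betw r₀ r₂ k := by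
    rintro k (hk | hk) (h | h)
    · exact hk.not_ge h.1
    · exact hr.not_ge (h.1.trans h.2)
    · exact hk.not_ge h.2
    · exact hr.not_ge (h.1.trans h.2)
  refine disjoint_union_left.2 ⟨disjoint_union_left.2 ⟨?_, ?_⟩, disjoint_union_left.2 ⟨?_, ?_⟩⟩
  · exact G.disjoint_S_frame hR.ne (hR.trans hr).ne (fun _ => b₂ _ (.inl hR)) fun _ => b₂ _ (.inl hR)
  · exact G.disjoint_S_frame (hr.trans hR').ne' hR'.ne' (fun _ => b₂ _ (.inr hR'))
      fun _ => b₂ _ (.inr hR')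
  · exact G.disjoint_U_frame hC.ne (hC.trans hc).ne (fun _ => b₁ _ (.inl hC)) fun _ => b₁ _ (.inl hC)
  · exact G.disjoint_U_frame (hc.trans hC').ne' hC'.ne' (fun _ => b₁ _ (.inr hC'))
      fun _ => b₁ _ (.inr hC')

end

/-- Every infinite grid in a disk contains a subgrid enclosed by a frame inside of the disk. -/
theorem exists_comap_inner_subset (G : Grid ℕ ℕ) {B : Set ℂ} (hB : IsPathConnected Bᶜ)
    (hS : ∀ j a b, G.S j a b ⊆ B) (hU : ∀ i a b, G.U i a b ⊆ B) (n : ℕ) :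
    ∃ (f g : ℕ → ℕ) (hf : BetwMap f) (hg : BetwMap g),
      (G.comap hf hg).inner 0 (n + 2) 0 (n + 2) 1 1 ⊆ B := by
  have h₁ : StrictMono fun k : ℕ => 2 * k := fun a b h => by dsimp only; omega
  have h₂ : StrictMono fun k : ℕ => 2 * k + 1 := fun a b h => by dsimp only; omega
  have h₃ : StrictMono fun k : ℕ => n + 3 + k := fun a b h => by dsimp only; omega
  rcases G.inner_subset_or hB hS hU (c₀ := 0) (c₁ := 1) (c₂ := n + 2) (d₀ := n + 3 + 0)
    (d₁ := n + 3 + 1) (d₂ := n + 3 + (n + 2)) (r₀ := 2 * 0) (r₁ := 2 * 1) (r₂ := 2 * (n + 2))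
    (s₀ := 2 * 0 + 1) (s₁ := 2 * 1 + 1) (s₂ := 2 * (n + 2) + 1) (by omega) (by omega) (by omega)
    (by omega) (by omega) (by omega) (by omega) (by omega) (by omega) (by omega) (by omega)
    with h | h
  · exact ⟨id, _, strictMono_id.betwMap, h₁.betwMap, h⟩
  · exact ⟨_, _, h₃.betwMap, h₂.betwMap, h⟩

end Grid

namespace Grid

section

variable {ι κ : Type*} [LinearOrder ι] [LinearOrder κ]

/-- There is an arm from the point `z i j` to the side `e` of a frame, which lies in `X` outside
of a neighborhood `N` of `z i j`. -/
def Arm (G : Grid ι κ) (c c' : ι) (r r' : κ) (i : ι) (j : κ) (e : ι) (N X : Set ℂ) : Prop :=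
  ∃ α : Set ℂ, IsPathConnected α ∧ G.z i j ∈ α ∧ (α ∩ G.U e r r').Nonempty ∧
    α ⊆ G.inner c c' r r' i j ∪ G.U e r r' ∧ α ⊆ N ∪ X

theorem arm_comm_left (G : Grid ι κ) (c c' : ι) (r r' : κ) (i : ι) (j : κ) (e : ι) (N X : Set ℂ) :
    G.Arm c c' r r' i j e N X ↔ G.Arm c' c r r' i j e N X := by
  rw [Arm, Arm, inner_comm_left]

theorem arm_comm_right (G : Grid ι κ) (c c' : ι) (r r' : κ) (i : ι) (j : κ) (e : ι)
    (N X : Set ℂ) : G.Arm c c' r r' i j e N X ↔ G.Arm c c' r' r i j e N X := by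
  rw [Arm, Arm, inner_comm_right, U_comm]

theorem crossing (G : Grid ι κ) {f : Fin 7 → ι} {g : Fin 7 → κ} (hf : BetwMap f) (hg : BetwMap g)
    {N N' X Y : Set ℂ}
    (h : G.Arm (f 0) (f 5) (g 2) (g 4) (f 4) (g 3) (f 0) N X)
    (h' : G.swap.Arm (g 0) (g 5) (f 1) (f 3) (g 1) (f 2) (g 5) N' Y) (hXY : Disjoint X Y)
    (hN : IsPathConnected N) (hNz : G.z (f 4) (g 3) ∈ N)
    (hNd : Disjoint N (G.frame (f 1) (f 3) (g 0) (g 5)))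
    (hN' : IsPathConnected N') (hNz' : G.z (f 2) (g 1) ∈ N')
    (hNd' : Disjoint N' (G.frame (f 0) (f 5) (g 2) (g 4))) : False := by
  obtain ⟨α, hα, hαz, hαm, hαV, hαX⟩ := h
  obtain ⟨β, hβ, hβz, hβm, hβV, hβY⟩ := h'
  rw [swap_inner] at hβV
  exact (G.comap hf hg).crossing_local hα hαz hαm hαV hαX hβ hβz hβm hβV hβY hXY hN hNz hNd
    hN' hNz' hNd'

theorem mem_inner_of_mem_closure (G : Grid ι κ) {c c' i : ι} {r r' j : κ} {y : ℂ}
    (hy : y ∈ closure (G.inner c c' r r' i j)) (hyf : y ∉ G.frame c c' r r') :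
    y ∈ G.inner c c' r r' i j := by
  have ho : IsOpen (pathComponentIn (G.frame c c' r r')ᶜ y) :=
    (G.isClosed_frame c c' r r').isOpen_compl.pathComponentIn y
  obtain ⟨x, hx, hx'⟩ := mem_closure_iff.1 hy _ ho (mem_pathComponentIn_self hyf)
  exact JoinedIn.trans hx' (JoinedIn.symm hx)

theorem exists_arm (G : Grid ι κ) {M : Type*} [TopologicalSpace M] [T2Space M] {ψ : ℂ → M}
    (hψ : IsOpenEmbedding ψ) {f : ℝ → M} (hf : Continuous f) (hd : DenseRange f)
    (hS : ∀ j a b, Disjoint (G.S j a b) (ψ ⁻¹' range f)) {c c' i : ι} {r r' j : κ} {N B : Set ℂ}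
    (hNo : IsOpen N) (hN : IsPathConnected N) (hNz : G.z i j ∈ N)
    (hNd : Disjoint N (G.frame c c' r r')) (hB : Bornology.IsBounded B)
    (hFB : G.frame c c' r r' ⊆ B) (hV : G.inner c c' r r' i j ⊆ B) :
    G.Arm c c' r r' i j c N (ψ ⁻¹' range f ∩ B) ∨
      G.Arm c c' r r' i j c' N (ψ ⁻¹' range f ∩ B) := by
  set V := G.inner c c' r r' i j with hVdef
  have hVo : IsOpen V := (G.isClosed_frame c c' r r').isOpen_compl.pathComponentIn _
  have hVc : IsCompact (closure V) := (hB.subset hV).isCompact_closure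
  have hNV : N ⊆ V := hN.subset_pathComponentIn hNz (subset_compl_iff_disjoint_right.2 hNd)
  have hK : IsClosed (ψ '' closure V) := (hVc.image hψ.continuous).isClosed
  obtain ⟨t₀, ht₀⟩ := hd.exists_mem_open (hψ.isOpenMap N hNo) ⟨_, mem_image_of_mem ψ hNz⟩
  obtain ⟨t₁, ht₁⟩ : ∃ t, f t ∉ ψ '' closure V := by
    refine hd.exists_mem_open hK.isOpen_compl ?_
    have : closure V ≠ univ := fun h => noncompact_univ ℂ (h ▸ hVc)
    obtain ⟨w, hw⟩ := (ne_univ_iff_exists_notMem _).1 this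
    exact ⟨ψ w, fun h => hw ((hψ.injective.mem_set_image).1 h)⟩
  let g : ℝ → M := fun s => f (t₀ + s * (t₁ - t₀))
  have hg : Continuous g := hf.comp (by fun_prop)
  let A : Set ℝ := Icc 0 1 ∩ g ⁻¹' (ψ '' V)ᶜ
  have hA : IsClosed A := isClosed_Icc.inter ((hψ.isOpenMap V hVo).isClosed_compl.preimage hg)
  have hA1 : (1 : ℝ) ∈ A := ⟨by simp, fun h => ht₁ (by
    have := image_mono subset_closure h
    simpa [g] using this)⟩
  have hAb : BddBelow A := ⟨0, fun s hs => hs.1.1⟩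
  obtain ⟨hτ0, hτA⟩ := hA.csInf_mem ⟨1, hA1⟩ hAb
  set τ := sInf A with hτ
  have hlt : ∀ s ∈ Ico 0 τ, g s ∈ ψ '' V := fun s hs => by
    by_contra h
    exact (csInf_le hAb ⟨⟨hs.1, hs.2.le.trans hτ0.2⟩, h⟩).not_gt hs.2
  have hτpos : 0 < τ := hτ0.1.lt_of_ne fun h => hτA (by
    rw [← h]
    simpa [g] using image_mono hNV ht₀)
  obtain ⟨y, hyV, hy⟩ : g τ ∈ ψ '' closure V := by
    have h₁ : τ ∈ closure (Ico 0 τ) := by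
      rw [closure_Ico hτpos.ne]; exact right_mem_Icc.2 hτpos.le
    exact hK.closure_subset_iff.2 (image_mono subset_closure) (hg.closure_preimage_subset _
      (closure_mono hlt h₁))
  have hyf : y ∈ G.frame c c' r r' := by
    by_contra h
    exact hτA ⟨y, G.mem_inner_of_mem_closure hyV h, hy⟩
  have hsub : g '' Icc 0 τ ⊆ range ψ := by
    rintro _ ⟨s, hs, rfl⟩
    rcases hs.2.eq_or_lt with rfl | h
    · exact ⟨y, hy⟩
    · exact image_subset_range _ _ (hlt s ⟨hs.1, h⟩)
  have hpc : IsPathConnected (ψ ⁻¹' (g '' Icc 0 τ)) := by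
    rw [hψ.isInducing.isPathConnected_iff, image_preimage_eq_of_subset hsub]
    exact ((convex_Icc (0 : ℝ) τ).isPathConnected ⟨0, by simp [hτpos.le]⟩).image hg
  have hgX : g '' Icc 0 τ ⊆ range f := by
    rintro _ ⟨s, -, rfl⟩; exact mem_range_self _
  obtain ⟨x₀, hx₀, hx₀'⟩ := ht₀
  have hα : IsPathConnected (N ∪ ψ ⁻¹' (g '' Icc 0 τ)) :=
    hN.union hpc ⟨x₀, hx₀, 0, by simp [hτpos.le], by simp [g, hx₀']⟩
  have hyα : y ∈ N ∪ ψ ⁻¹' (g '' Icc 0 τ) := .inr ⟨τ, right_mem_Icc.2 hτpos.le, hy.symm⟩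
  have hyX : y ∈ ψ ⁻¹' range f := by
    rw [mem_preimage, hy]; exact mem_range_self _
  have hαV : ∀ x ∈ ψ ⁻¹' (g '' Icc 0 τ), x = y ∨ x ∈ V := by
    rintro x ⟨s, hs, hsx⟩
    rcases hs.2.eq_or_lt with rfl | h
    · exact .inl (hψ.injective (hsx.symm.trans hy.symm))
    · have := hlt s ⟨hs.1, h⟩
      rw [hsx] at this
      exact .inr ((hψ.injective.mem_set_image).1 this)
  have key : ∀ e, y ∈ G.U e r r' → G.Arm c c' r r' i j e N (ψ ⁻¹' range f ∩ B) := fun e he => by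
    refine ⟨_, hα, .inl hNz, ⟨y, hyα, he⟩, union_subset (hNV.trans subset_union_left) fun x hx =>
      (hαV x hx).elim (fun h => .inr (h ▸ he)) .inl, union_subset_union_right _ fun x hx =>
      ⟨hgX hx, (hαV x hx).elim (fun h => h ▸ hFB hyf) fun h => hV h⟩⟩
  rcases hyf with (h | h) | (h | h)
  · exact (disjoint_left.1 (hS _ _ _) h hyX).elim
  · exact (disjoint_left.1 (hS _ _ _) h hyX).elim
  · exact .inl (key _ h)
  · exact .inr (key _ h)

end

end Grid

theorem pattern_left {L R D U : ℕ → ℕ → Prop} (hLR : ∀ k < 7, ∀ l < 7, L k l ∨ R k l)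
    (hDU : ∀ k < 7, ∀ l < 7, D k l ∨ U k l)
    (hLU : ∀ k < 7, ∀ l < 7, ∀ k' < k, ∀ l' < l, L k l → ¬U k' l')
    (hLD : ∀ k < 7, ∀ l' < 7, ∀ k' < k, ∀ l < l', L k l → ¬D k' l')
    (hRU : ∀ k' < 7, ∀ l < 7, ∀ k < k', ∀ l' < l, R k l → ¬U k' l')
    (hRD : ∀ k' < 7, ∀ l' < 7, ∀ k < k', ∀ l < l', R k l → ¬D k' l') : ¬L 3 2 := by
  intro h
  have d₁ : D 2 1 := (hDU 2 (by decide) 1 (by decide)).resolve_right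
    (hLU 3 (by decide) 2 (by decide) 2 (by decide) 1 (by decide) h)
  have u₁ : U 2 3 := (hDU 2 (by decide) 3 (by decide)).resolve_left
    (hLD 3 (by decide) 3 (by decide) 2 (by decide) 2 (by decide) h)
  have r₁ : R 3 0 := (hLR 3 (by decide) 0 (by decide)).resolve_left fun h =>
    hLD 3 (by decide) 1 (by decide) 2 (by decide) 0 (by decide) h d₁
  have r₂ : R 3 4 := (hLR 3 (by decide) 4 (by decide)).resolve_left fun h =>
    hLU 3 (by decide) 4 (by decide) 2 (by decide) 3 (by decide) h u₁
  have u₂ : U 4 1 := (hDU 4 (by decide) 1 (by decide)).resolve_left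
    (hRD 4 (by decide) 1 (by decide) 3 (by decide) 0 (by decide) r₁)
  have d₂ : D 4 3 := (hDU 4 (by decide) 3 (by decide)).resolve_right
    (hRU 4 (by decide) 4 (by decide) 3 (by decide) 3 (by decide) r₂)
  have r₃ : R 5 3 := (hLR 5 (by decide) 3 (by decide)).resolve_left fun h =>
    hLU 5 (by decide) 3 (by decide) 4 (by decide) 1 (by decide) h u₂
  have r₄ : R 5 1 := (hLR 5 (by decide) 1 (by decide)).resolve_left fun h =>
    hLD 5 (by decide) 3 (by decide) 4 (by decide) 1 (by decide) h d₂
  exact (hDU 6 (by decide) 2 (by decide)).elim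
    (hRD 6 (by decide) 2 (by decide) 5 (by decide) 1 (by decide) r₄)
    (hRU 6 (by decide) 3 (by decide) 5 (by decide) 2 (by decide) r₃)

theorem pattern_false {L R D U : ℕ → ℕ → Prop} (hLR : ∀ k < 7, ∀ l < 7, L k l ∨ R k l)
    (hDU : ∀ k < 7, ∀ l < 7, D k l ∨ U k l)
    (hLU : ∀ k < 7, ∀ l < 7, ∀ k' < k, ∀ l' < l, L k l → ¬U k' l')
    (hLD : ∀ k < 7, ∀ l' < 7, ∀ k' < k, ∀ l < l', L k l → ¬D k' l')
    (hRU : ∀ k' < 7, ∀ l < 7, ∀ k < k', ∀ l' < l, R k l → ¬U k' l')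
    (hRD : ∀ k' < 7, ∀ l' < 7, ∀ k < k', ∀ l < l', R k l → ¬D k' l') : False := by
  refine (hLR 3 (by decide) 2 (by decide)).elim (pattern_left hLR hDU hLU hLD hRU hRD) ?_
  refine pattern_left (L := fun k => R (6 - k)) (R := fun k => L (6 - k)) (D := fun k => D (6 - k))
    (U := fun k => U (6 - k)) (fun k hk l hl => (hLR _ (by omega) l hl).symm)
    (fun k hk l hl => hDU _ (by omega) l hl) ?_ ?_ ?_ ?_
  · exact fun k hk l hl k' hk' l' hl' => hRU _ (by omega) _ hl _ (by omega) _ hl'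
  · exact fun k hk l hl k' hk' l' hl' => hRD _ (by omega) _ hl _ (by omega) _ hl'
  · exact fun k hk l hl k' hk' l' hl' => hLU _ (by omega) _ hl _ (by omega) _ hl'
  · exact fun k hk l hl k' hk' l' hl' => hLD _ (by omega) _ hl _ (by omega) _ hl'

theorem strictMono_vec {α : Type*} [Preorder α] {x₀ x₁ x₂ x₃ x₄ x₅ x₆ : α} (h₀ : x₀ < x₁)
    (h₁ : x₁ < x₂) (h₂ : x₂ < x₃) (h₃ : x₃ < x₄) (h₄ : x₄ < x₅) (h₅ : x₅ < x₆) :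
    StrictMono ![x₀, x₁, x₂, x₃, x₄, x₅, x₆] := by
  rw [Fin.strictMono_iff_lt_succ]
  intro i; fin_cases i <;> assumption

theorem strictAnti_vec {α : Type*} [Preorder α] {x₀ x₁ x₂ x₃ x₄ x₅ x₆ : α} (h₀ : x₁ < x₀)
    (h₁ : x₂ < x₁) (h₂ : x₃ < x₂) (h₃ : x₄ < x₃) (h₄ : x₅ < x₄) (h₅ : x₆ < x₅) :
    StrictAnti ![x₀, x₁, x₂, x₃, x₄, x₅, x₆] := by
  rw [Fin.strictAnti_iff_succ_lt]
  intro i; fin_cases i <;> assumption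

namespace Grid

theorem exists_nhd (G : Grid ℕ ℕ) (k l : ℕ) (hk : k < 7) (hl : l < 7) :
    ∃ N : Set ℂ, IsOpen N ∧ IsPathConnected N ∧ G.z (2 * k + 3) (2 * l + 3) ∈ N ∧
      (∀ k' < 7, Disjoint N (G.frame (2 * k' + 2) (2 * k' + 4) 1 17)) ∧
      ∀ l' < 7, Disjoint N (G.frame 1 17 (2 * l' + 2) (2 * l' + 4)) := by
  let F : Set ℂ := ⋃ m : Fin 7, (G.frame (2 * m + 2) (2 * m + 4) 1 17 ∪
    G.frame 1 17 (2 * m + 2) (2 * m + 4))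
  have hF : IsClosed F := isClosed_iUnion_of_finite fun m =>
    (G.isClosed_frame _ _ _ _).union (G.isClosed_frame _ _ _ _)
  have hz : G.z (2 * k + 3) (2 * l + 3) ∈ Fᶜ := by
    simp only [F, mem_compl_iff, mem_iUnion, not_exists]
    rintro m (h | h)
    · exact G.z_notMem_frame (by omega) (by omega) (by omega) (by omega) h
    · exact G.z_notMem_frame (by omega) (by omega) (by omega) (by omega) h
  obtain ⟨ε, hε, hb⟩ := Metric.isOpen_iff.1 hF.isOpen_compl _ hz
  refine ⟨_, Metric.isOpen_ball, (convex_ball _ ε).isPathConnected ⟨_, Metric.mem_ball_self hε⟩,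
    Metric.mem_ball_self hε, fun k' hk' => ?_, fun l' hl' => ?_⟩
  · refine (subset_compl_iff_disjoint_right.1 hb).mono_right ?_
    exact subset_union_left.trans (subset_iUnion (fun m : Fin 7 => G.frame (2 * m + 2) (2 * m + 4) 1 17 ∪
      G.frame 1 17 (2 * m + 2) (2 * m + 4)) ⟨k', hk'⟩)
  · refine (subset_compl_iff_disjoint_right.1 hb).mono_right ?_
    exact subset_union_right.trans (subset_iUnion (fun m : Fin 7 => G.frame (2 * m + 2) (2 * m + 4) 1 17 ∪
      G.frame 1 17 (2 * m + 2) (2 * m + 4)) ⟨l', hl'⟩)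

theorem false_of_enclosed (G : Grid ℕ ℕ) {M : Type*} [TopologicalSpace M] [T2Space M] {ψ : ℂ → M}
    (hψ : IsOpenEmbedding ψ) {f g : ℝ → M} (hf : Continuous f) (hfd : DenseRange f)
    (hg : Continuous g) (hgd : DenseRange g)
    (hS : ∀ j a b, Disjoint (G.S j a b) (ψ ⁻¹' range f))
    (hU : ∀ i a b, Disjoint (G.U i a b) (ψ ⁻¹' range g)) {B : Set ℂ}
    (hB : Bornology.IsBounded B) (hSB : ∀ j a b, G.S j a b ⊆ B) (hUB : ∀ i a b, G.U i a b ⊆ B)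
    (hin : G.inner 0 18 0 18 1 1 ⊆ B)
    (hfg : Disjoint (ψ ⁻¹' range f ∩ B) (ψ ⁻¹' range g ∩ B)) : False := by
  have hin' : ∀ i j, 0 < i → i < 18 → 0 < j → j < 18 → G.inner 0 18 0 18 i j ⊆ B :=
    fun i j h₁ h₂ h₃ h₄ => by
      rwa [G.inner_congr_left h₁ h₂ (i' := 1) (by omega) (by omega) (by omega) (by omega),
        G.inner_congr_right h₃ h₄ (j' := 1) (by omega) (by omega) (by omega) (by omega)]
  have hex : ∀ k l, ∃ N : Set ℂ, k < 7 → l < 7 → IsOpen N ∧ IsPathConnected N ∧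
      G.z (2 * k + 3) (2 * l + 3) ∈ N ∧
      (∀ k' < 7, Disjoint N (G.frame (2 * k' + 2) (2 * k' + 4) 1 17)) ∧
      ∀ l' < 7, Disjoint N (G.frame 1 17 (2 * l' + 2) (2 * l' + 4)) := fun k l => by
    by_cases h : k < 7 ∧ l < 7
    · obtain ⟨N, hN⟩ := G.exists_nhd k l h.1 h.2
      exact ⟨N, fun _ _ => hN⟩
    · exact ⟨∅, fun h₁ h₂ => (h ⟨h₁, h₂⟩).elim⟩
  choose N hN using hex
  have hsub := G.frame_subset hSB hUB
  let X := ψ ⁻¹' range f ∩ B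
  let Y := ψ ⁻¹' range g ∩ B
  let H : ℕ → ℕ → ℕ → Prop := fun e k l =>
    G.Arm 1 17 (2 * l + 2) (2 * l + 4) (2 * k + 3) (2 * l + 3) e (N k l) X
  let K : ℕ → ℕ → ℕ → Prop := fun e k l =>
    G.swap.Arm 1 17 (2 * k + 2) (2 * k + 4) (2 * l + 3) (2 * k + 3) e (N k l) Y
  refine pattern_false (L := H 1) (R := H 17) (D := K 1) (U := K 17) ?_ ?_ ?_ ?_ ?_ ?_
  · intro k hk l hl
    obtain ⟨h₁, h₂, h₃, h₄, h₅⟩ := hN k l hk hl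
    refine G.exists_arm hψ hf hfd hS h₁ h₂ h₃ (h₅ l hl) hB (hsub _ _ _ _) ?_
    exact G.inner_subset_of_inner_subset (C := 0) (C' := 18) (R := 0) (R' := 18) (by omega)
      (by omega) (by omega) (by omega) (by omega) (by omega) (by omega) (by omega)
      (hin' _ _ (by omega) (by omega) (by omega) (by omega))
  · intro k hk l hl
    obtain ⟨h₁, h₂, h₃, h₄, h₅⟩ := hN k l hk hl
    refine G.swap.exists_arm hψ hg hgd hU h₁ h₂ h₃ ?_ hB ?_ ?_
    · rw [swap_frame]
      exact h₄ k hk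
    · rw [swap_frame]
      exact hsub _ _ _ _
    · rw [swap_inner]
      exact G.inner_subset_of_inner_subset (C := 0) (C' := 18) (R := 0) (R' := 18) (by omega)
        (by omega) (by omega) (by omega) (by omega) (by omega) (by omega) (by omega)
        (hin' _ _ (by omega) (by omega) (by omega) (by omega))
  · intro k hk l hl k' hk' l' hl' h h'
    obtain ⟨-, h₂, h₃, h₄, -⟩ := hN k l hk hl
    obtain ⟨-, h₂', h₃', -, h₅⟩ := hN k' l' (by omega) (by omega)
    exact G.crossing (f := ![1, 2 * k' + 2, 2 * k' + 3, 2 * k' + 4, 2 * k + 3, 17, 18])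
      (g := ![1, 2 * l' + 3, 2 * l + 2, 2 * l + 3, 2 * l + 4, 17, 18])
      (strictMono_vec (by omega) (by omega) (by omega) (by omega) (by omega) (by omega)).betwMap
      (strictMono_vec (by omega) (by omega) (by omega) (by omega) (by omega) (by omega)).betwMap
      h h' hfg h₂ h₃ (h₄ k' (by omega)) h₂' h₃' (h₅ l hl)
  · intro k hk l' hl' k' hk' l hl h h'
    obtain ⟨-, h₂, h₃, h₄, -⟩ := hN k l (by omega) (by omega)
    obtain ⟨-, h₂', h₃', -, h₅⟩ := hN k' l' (by omega) (by omega)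
    refine G.crossing (f := ![1, 2 * k' + 2, 2 * k' + 3, 2 * k' + 4, 2 * k + 3, 17, 18])
      (g := ![17, 2 * l' + 3, 2 * l + 4, 2 * l + 3, 2 * l + 2, 1, 0])
      (strictMono_vec (by omega) (by omega) (by omega) (by omega) (by omega) (by omega)).betwMap
      (strictAnti_vec (by omega) (by omega) (by omega) (by omega) (by omega) (by omega)).betwMap
      ((G.arm_comm_right ..).1 h) ((G.swap.arm_comm_left ..).1 h') hfg h₂ h₃ ?_ h₂' h₃' ?_
    · exact (G.frame_comm_right ..) ▸ h₄ k' (by omega)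
    · exact (G.frame_comm_right ..) ▸ h₅ l (by omega)
  · intro k' hk' l hl k hk l' hl' h h'
    obtain ⟨-, h₂, h₃, h₄, -⟩ := hN k l (by omega) (by omega)
    obtain ⟨-, h₂', h₃', -, h₅⟩ := hN k' l' (by omega) (by omega)
    refine G.crossing (f := ![17, 2 * k' + 4, 2 * k' + 3, 2 * k' + 2, 2 * k + 3, 1, 0])
      (g := ![1, 2 * l' + 3, 2 * l + 2, 2 * l + 3, 2 * l + 4, 17, 18])
      (strictAnti_vec (by omega) (by omega) (by omega) (by omega) (by omega) (by omega)).betwMap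
      (strictMono_vec (by omega) (by omega) (by omega) (by omega) (by omega) (by omega)).betwMap
      ((G.arm_comm_left ..).1 h) ((G.swap.arm_comm_right ..).1 h') hfg h₂ h₃ ?_ h₂' h₃' ?_
    · exact (G.frame_comm_left ..) ▸ h₄ k' (by omega)
    · exact (G.frame_comm_left ..) ▸ h₅ l (by omega)
  · intro k' hk' l' hl' k hk l hl h h'
    obtain ⟨-, h₂, h₃, h₄, -⟩ := hN k l (by omega) (by omega)
    obtain ⟨-, h₂', h₃', -, h₅⟩ := hN k' l' (by omega) (by omega)
    refine G.crossing (f := ![17, 2 * k' + 4, 2 * k' + 3, 2 * k' + 2, 2 * k + 3, 1, 0])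
      (g := ![17, 2 * l' + 3, 2 * l + 4, 2 * l + 3, 2 * l + 2, 1, 0])
      (strictAnti_vec (by omega) (by omega) (by omega) (by omega) (by omega) (by omega)).betwMap
      (strictAnti_vec (by omega) (by omega) (by omega) (by omega) (by omega) (by omega)).betwMap
      ((G.arm_comm_left ..).1 ((G.arm_comm_right ..).1 h)) ((G.swap.arm_comm_left ..).1 ((G.swap.arm_comm_right ..).1 h')) hfg h₂ h₃ ?_ h₂' h₃' ?_
    · exact (G.frame_comm_left ..) ▸ (G.frame_comm_right ..) ▸ h₄ k' (by omega)
    · exact (G.frame_comm_left ..) ▸ (G.frame_comm_right ..) ▸ h₅ l (by omega)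

theorem false_of_dense (G : Grid ℕ ℕ) {M : Type*} [TopologicalSpace M] [T2Space M] {ψ : ℂ → M}
    (hψ : IsOpenEmbedding ψ) {f g : ℝ → M} (hf : Continuous f) (hfd : DenseRange f)
    (hg : Continuous g) (hgd : DenseRange g)
    (hS : ∀ j a b, Disjoint (G.S j a b) (ψ ⁻¹' range f))
    (hU : ∀ i a b, Disjoint (G.U i a b) (ψ ⁻¹' range g)) {B : Set ℂ}
    (hB : Bornology.IsBounded B) (hBc : IsPathConnected Bᶜ) (hSB : ∀ j a b, G.S j a b ⊆ B)
    (hUB : ∀ i a b, G.U i a b ⊆ B)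
    (hfg : Disjoint (ψ ⁻¹' range f ∩ B) (ψ ⁻¹' range g ∩ B)) : False := by
  obtain ⟨u, v, hu, hv, h⟩ := G.exists_comap_inner_subset hBc hSB hUB 16
  exact (G.comap hu hv).false_of_enclosed hψ hf hfd hg hgd (fun _ _ _ => hS _ _ _)
    (fun _ _ _ => hU _ _ _) hB (fun _ _ _ => hSB _ _ _) (fun _ _ _ => hUB _ _ _) h hfg

end Grid

theorem exists_betwMap_subseq {s : ℕ → ℕ → ℝ} (hs : ∀ j, Injective (s j))
    (hc : ∀ j j' i i', s j i ≤ s j i' ↔ s j' i ≤ s j' i') :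
    ∃ g : ℕ → ℕ, Injective g ∧ ∀ j, BetwMap fun i => s j (g i) := by
  obtain ⟨g, hg | hg⟩ := exists_increasing_or_nonincreasing_subseq (· ≤ ·) (s 0)
  · refine ⟨g, g.injective, fun j => StrictMono.betwMap fun a b h => ?_⟩
    exact ((hc j 0 _ _).2 (hg a b h)).lt_of_ne ((hs j).ne (g.injective.ne h.ne))
  · refine ⟨g, g.injective, fun j => StrictAnti.betwMap fun a b h => ?_⟩
    exact not_le.1 fun h' => hg a b h ((hc j 0 _ _).1 h')

/-- Transverse families of arcs in a chart, crossing each other in a consistent order,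
form a grid. -/
theorem Grid.exists_of_arcs {M : Type*} [TopologicalSpace M] [T2Space M] {ψ : ℂ → M}
    (hψ : IsOpenEmbedding ψ) {p : ℕ → ℕ → M} {A B : ℕ → Set M} {f g : ℕ → ℝ → M}
    {s t : ℕ → ℕ → ℝ} (hf : ∀ j, Continuous (f j)) (hfi : ∀ j, Injective (f j))
    (hg : ∀ i, Continuous (g i)) (hgi : ∀ i, Injective (g i))
    (hfp : ∀ i j, f j (s j i) = p i j) (hgp : ∀ i j, g i (t i j) = p i j)
    (hfA : ∀ j i i', f j '' uIcc (s j i) (s j i') ⊆ A j)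
    (hgB : ∀ i j j', g i '' uIcc (t i j) (t i j') ⊆ B i)
    (hA : ∀ j, A j ⊆ range ψ) (hB : ∀ i, B i ⊆ range ψ) (hAd : Pairwise (Disjoint on A))
    (hBd : Pairwise (Disjoint on B)) (hAB : ∀ i j, A j ∩ B i ⊆ {p i j})
    (hs : ∀ j, BetwMap (s j)) (ht : ∀ i, BetwMap (t i)) :
    ∃ G : Grid ℕ ℕ, (∀ j a b, G.S j a b ⊆ ψ ⁻¹' A j) ∧ ∀ i a b, G.U i a b ⊆ ψ ⁻¹' B i := by
  have hp : ∀ i j, ∃ z, ψ z = p i j := fun i j =>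
    hA j (hfA j i i ⟨_, left_mem_uIcc, hfp i j⟩)
  choose z hz using hp
  have conn : ∀ (h : ℝ → M) (a b : ℝ), Continuous h → h '' uIcc a b ⊆ range ψ →
      IsPathConnected (ψ ⁻¹' (h '' uIcc a b)) := fun h a b hh hr => by
    rw [hψ.isInducing.isPathConnected_iff, image_preimage_eq_of_subset hr]
    exact ((convex_uIcc a b).isPathConnected nonempty_uIcc).image hh
  have clos : ∀ (h : ℝ → M) (a b : ℝ), Continuous h → IsClosed (ψ ⁻¹' (h '' uIcc a b)) :=
    fun h a b hh => (isCompact_uIcc.image hh).isClosed.preimage hψ.continuous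
  let G : Grid ℕ ℕ :=
    { z := z
      S := fun j a b => ψ ⁻¹' (f j '' uIcc (s j a) (s j b))
      U := fun i a b => ψ ⁻¹' (g i '' uIcc (t i a) (t i b))
      z_mem_S := fun {a b k} j h =>
        ⟨s j k, mem_uIcc.2 (((hs j).iff a b k).2 h), (hfp k j).trans (hz k j).symm⟩
      z_mem_U := fun {a b k} i h =>
        ⟨t i k, mem_uIcc.2 (((ht i).iff a b k).2 h), (hgp i k).trans (hz i k).symm⟩
      conn_S := fun j a b => conn _ _ _ (hf j) ((hfA j a b).trans (hA j))
      conn_U := fun i a b => conn _ _ _ (hg i) ((hgB i a b).trans (hB i))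
      closed_S := fun j a b => clos _ _ _ (hf j)
      closed_U := fun i a b => clos _ _ _ (hg i)
      mono_S := fun {a b k k'} j h h' => preimage_mono (image_mono (uIcc_subset_uIcc
        (mem_uIcc.2 (((hs j).iff a b k).2 h)) (mem_uIcc.2 (((hs j).iff a b k').2 h'))))
      mono_U := fun {a b k k'} i h h' => preimage_mono (image_mono (uIcc_subset_uIcc
        (mem_uIcc.2 (((ht i).iff a b k).2 h)) (mem_uIcc.2 (((ht i).iff a b k').2 h'))))
      disj_S := fun _ _ _ _ h =>
        ((hAd h).mono (hfA _ _ _) (hfA _ _ _)).preimage ψ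
      disj_U := fun _ _ _ _ h =>
        ((hBd h).mono (hgB _ _ _) (hgB _ _ _)).preimage ψ
      disj_SU := fun {a b l l' i j} h => by
        rw [disjoint_left]
        intro x hx hx'
        have hxp : ψ x = p i j := hAB i j ⟨hfA _ _ _ hx, hgB _ _ _ hx'⟩
        obtain ⟨u, hu, hux⟩ := hx
        obtain ⟨v, hv, hvx⟩ := hx'
        have h₁ : u = s j i := hfi j (by rw [hux, hxp, hfp])
        have h₂ : v = t i j := hgi i (by rw [hvx, hxp, hgp])
        subst h₁ h₂
        exact h ⟨((hs j).iff _ _ _).1 (mem_uIcc.1 hu), ((ht i).iff _ _ _).1 (mem_uIcc.1 hv)⟩ }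
  exact ⟨G, fun j a b => preimage_mono (hfA j a b), fun i a b => preimage_mono (hgB i a b)⟩

theorem Tartan.exists_grid {M : Type} [TopologicalSpace M] [T2Space M] [MeasurableSpace M]
    {μ : Measure M} {Ts Tu : MeasuredTurbulation μ} (R : Tartan Ts Tu) {A B : ℕ → Set M}
    (hA : ∀ j, A j ∈ R.fibs) (hB : ∀ i, B i ∈ R.fibu) (hAi : Injective A) (hBi : Injective B)
    {ψ : ℂ → M} (hψ : IsOpenEmbedding ψ) (hAψ : ∀ j, A j ⊆ range ψ) (hBψ : ∀ i, B i ⊆ range ψ) :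
    ∃ (G : Grid ℕ ℕ) (g h : ℕ → ℕ), (∀ j a b, G.S j a b ⊆ ψ ⁻¹' A (h j)) ∧
      ∀ i a b, G.U i a b ⊆ ψ ⁻¹' B (g i) := by
  obtain ⟨ords, ordu, hs, hu, hsc, huc⟩ := R.oriented
  have hp : ∀ i j, ∃! z, z ∈ A j ∩ B i := fun i j => R.inter_unique _ (hA j) _ (hB i)
  choose p hpm hpu using hp
  have hs' := fun j => hs _ (hA j)
  choose ℓ hℓ f hfc hfi hfr a b hab hfA hfo using hs'
  have hu' := fun i => hu _ (hB i)
  choose m hm g hgc hgi hgr c d hcd hgB hgo using hu'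
  have hs₁ : ∀ j i, ∃ x ∈ Icc (a j) (b j), f j x = p i j := fun j i => by
    have := (hpm i j).1
    rwa [hfA j] at this
  choose s hsm hsp using hs₁
  have ht₁ : ∀ i j, ∃ x ∈ Icc (c i) (d i), g i x = p i j := fun i j => by
    have := (hpm i j).2
    rwa [hgB i] at this
  choose t htm htp using ht₁
  have hAd : Pairwise (Disjoint on A) := fun j j' h =>
    R.fibs_disjoint (hA j) (hA j') (hAi.ne h)
  have hBd : Pairwise (Disjoint on B) := fun j j' h =>
    R.fibu_disjoint (hB j) (hB j') (hBi.ne h)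
  have hsi : ∀ j, Injective (s j) := fun j i i' h => by
    by_contra hne
    refine disjoint_left.1 (hBd hne) (hpm i j).2 ?_
    rw [← hsp j i, h, hsp]
    exact (hpm i' j).2
  have hti : ∀ i, Injective (t i) := fun i j j' h => by
    by_contra hne
    refine disjoint_left.1 (hAd hne) (hpm i j).1 ?_
    rw [← htp i j, h, htp]
    exact (hpm i j').1
  have hsord : ∀ j j' i i', s j i ≤ s j i' ↔ s j' i ≤ s j' i' := fun j j' i i' => by
    rw [← hfo j _ (hsm j i) _ (hsm j i'), ← hfo j' _ (hsm j' i) _ (hsm j' i'), hsp, hsp, hsp, hsp]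
    exact hsc _ (hA j) _ (hA j') _ (hB i) _ (hB i') _ (hpm i j) _ (hpm i' j) _ (hpm i j') _
      (hpm i' j')
  have htord : ∀ i i' j j', t i j ≤ t i j' ↔ t i' j ≤ t i' j' := fun i i' j j' => by
    rw [← hgo i _ (htm i j) _ (htm i j'), ← hgo i' _ (htm i' j) _ (htm i' j'), htp, htp, htp, htp]
    exact huc _ (hB i) _ (hB i') _ (hA j) _ (hA j') _ (hpm i j).symm _ (hpm i j').symm _
      (hpm i' j).symm _ (hpm i' j').symm
  obtain ⟨u, hui, hu⟩ := exists_betwMap_subseq hsi hsord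
  obtain ⟨v, hvi, hv⟩ := exists_betwMap_subseq hti htord
  obtain ⟨G, hG₁, hG₂⟩ := Grid.exists_of_arcs hψ (p := fun i j => p (u i) (v j))
    (A := fun j => A (v j)) (B := fun i => B (u i)) (f := fun j => f (v j)) (g := fun i => g (u i))
    (s := fun j i => s (v j) (u i)) (t := fun i j => t (u i) (v j))
    (fun _ => hfc _) (fun _ => hfi _) (fun _ => hgc _) (fun _ => hgi _) (fun _ _ => hsp _ _)
    (fun _ _ => htp _ _)
    (fun j i i' => (hfA (v j)).symm ▸ image_mono (uIcc_subset_Icc (hsm _ _) (hsm _ _)))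
    (fun i j j' => (hgB (u i)).symm ▸ image_mono (uIcc_subset_Icc (htm _ _) (htm _ _)))
    (fun _ => hAψ _) (fun _ => hBψ _) (fun _ _ h => hAd (hvi.ne h)) (fun _ _ h => hBd (hui.ne h))
    (fun i j x hx => hpu _ _ _ hx) (fun j => hu (v j)) (fun i => hv (u i))
  exact ⟨G, u, v, hG₁, hG₂⟩

theorem IsArcIn.isCompact {M : Type} [TopologicalSpace M] {ℓ A : Set M} {x y : M}
    (h : IsArcIn ℓ A x y) : IsCompact A := by
  obtain ⟨f, hf, -, -, a, b, -, -, -, rfl⟩ := h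
  exact isCompact_Icc.image hf

theorem IsArcIn.subset {M : Type} [TopologicalSpace M] {ℓ A : Set M} {x y : M}
    (h : IsArcIn ℓ A x y) : A ⊆ ℓ := by
  obtain ⟨f, -, -, rfl, a, b, -, -, -, rfl⟩ := h
  exact image_subset_range _ _

theorem IsArcIn.exists_ne {M : Type} [TopologicalSpace M] {ℓ A : Set M} {x y : M}
    (h : IsArcIn ℓ A x y) (hA : A.Nontrivial) : x ≠ y := by
  obtain ⟨f, -, hf, rfl, a, b, hab, rfl, rfl, rfl⟩ := h
  intro h
  rw [hf h, Icc_self, image_singleton] at hA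
  exact not_nontrivial_singleton hA

namespace MeasuredTurbulation

variable {M : Type} [TopologicalSpace M] [MeasurableSpace M] {μ : Measure M}

theorem sigmaFinite (T : MeasuredTurbulation μ) {ℓ : Set M} (hℓ : ℓ ∈ T.lines) :
    SigmaFinite (T.ν ℓ) := by
  obtain ⟨f, hf, hfi, hfr⟩ := T.lines_immersed ℓ hℓ
  refine ⟨⟨⟨fun n : ℕ => f '' Icc (-n) n ∪ ℓᶜ, fun _ => trivial, fun n => ?_, ?_⟩⟩⟩
  · refine (measure_union_le _ _).trans_lt ?_
    rw [T.ν_supported ℓ hℓ, add_zero]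
    exact T.ν_arc_finite ℓ hℓ _ _ _ ⟨f, hf, hfi, hfr, -n, n, 
      by have := n.cast_nonneg (α := ℝ); linarith, rfl, rfl, rfl⟩
  · rw [eq_univ_iff_forall]
    intro x
    by_cases hx : x ∈ ℓ
    · rw [← hfr] at hx
      obtain ⟨t, rfl⟩ := hx
      obtain ⟨n, hn⟩ := exists_nat_ge |t|
      exact mem_iUnion.2 ⟨n, .inl ⟨t, abs_le.1 hn, rfl⟩⟩
    · exact mem_iUnion.2 ⟨0, .inr hx⟩

/-- A streamline meets only countably many members of a disjoint family of stream arcs. -/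
theorem countable_arcs_meeting [T2Space M] [BorelSpace M] (T : MeasuredTurbulation μ) {ℓ : Set M}
    (hℓ : ℓ ∈ T.lines) {F : Set (Set M)} (hF : F.PairwiseDisjoint id)
    (hFa : ∀ A ∈ F, A.Nontrivial ∧ ∃ ℓ' ∈ T.lines, IsArc ℓ' A) :
    {A ∈ F | (A ∩ ℓ).Nonempty}.Countable := by
  have := T.sigmaFinite hℓ
  have h := Measure.countable_meas_pos_of_disjoint_iUnion (μ := T.ν ℓ)
    (As := fun A : {A ∈ F | (A ∩ ℓ).Nonempty} => (A : Set M)) (fun A => ?_) fun A A' h =>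
      hF A.2.1 A'.2.1 (Subtype.coe_injective.ne h)
  · rw [← countable_coe_iff, ← countable_univ_iff]
    refine h.mono ?_
    rintro ⟨A, hA, x, hxA, hxℓ⟩ -
    obtain ⟨hn, ℓ', hℓ', y, y', ha⟩ := hFa A hA
    obtain rfl : ℓ' = ℓ := T.lines_disjoint.elim_set hℓ' hℓ x (ha.subset hxA) hxℓ
    exact T.ν_arc_pos _ hℓ _ _ _ ha (ha.exists_ne hn)
  · obtain ⟨-, ℓ', hℓ', y, y', ha⟩ := hFa A A.2.1
    exact ha.isCompact.isClosed.measurableSet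

theorem measure_countable (T : MeasuredTurbulation μ) {ℓ : Set M} (hℓ : ℓ ∈ T.lines) {E : Set M}
    (hE : E.Countable) : T.ν ℓ E = 0 := by
  rw [← biUnion_of_singleton E]
  exact (measure_biUnion_null_iff hE).2 fun x _ => T.ν_nonatomic ℓ hℓ x

end MeasuredTurbulation

namespace Tartan

variable {M : Type} [TopologicalSpace M] [MeasurableSpace M] {μ : Measure M}
  {Ts Tu : MeasuredTurbulation μ}

theorem exists_isArc_fibs (R : Tartan Ts Tu) {A : Set M} (hA : A ∈ R.fibs) :
    ∃ ℓ ∈ Ts.lines, IsArc ℓ A := by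
  obtain ⟨ords, ordu, hs, hu, hsc, huc⟩ := R.oriented
  obtain ⟨ℓ, hℓ, f, hf, hfi, hfr, a, b, hab, h, -⟩ := hs A hA
  exact ⟨ℓ, hℓ, _, _, f, hf, hfi, hfr, a, b, hab, rfl, rfl, h⟩

theorem exists_isArc_fibu (R : Tartan Ts Tu) {B : Set M} (hB : B ∈ R.fibu) :
    ∃ ℓ ∈ Tu.lines, IsArc ℓ B := by
  obtain ⟨ords, ordu, hs, hu, hsc, huc⟩ := R.oriented
  obtain ⟨ℓ, hℓ, f, hf, hfi, hfr, a, b, hab, h, -⟩ := hu B hB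
  exact ⟨ℓ, hℓ, _, _, f, hf, hfi, hfr, a, b, hab, rfl, rfl, h⟩

theorem uncountable_fibers (R : Tartan Ts Tu) (hc : R.Compatible) (hR : 0 < μ R.core) :
    ¬R.fibs.Countable ∧ ¬R.fibu.Countable := by
  obtain ⟨x, hxs, hxu⟩ := nonempty_of_measure_ne_zero hR.ne'
  rw [← R.fibs_cover] at hxs
  rw [← R.fibu_cover] at hxu
  obtain ⟨A, hA, -⟩ := hxs
  obtain ⟨B, hB, -⟩ := hxu
  obtain ⟨ℓ, hℓ, y, y', ha⟩ := R.exists_isArc_fibs hA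
  obtain ⟨m, hm, w, w', hb⟩ := R.exists_isArc_fibu hB
  obtain ⟨φ, -, -, -, -, -, hφ⟩ := hc A hA B hB ℓ hℓ ha.subset m hm hb.subset
  have hpos : ∀ E : Set M, E.Countable → ∀ F : Set M, F.Countable → ¬(A ∩ R.core ⊆ E) ∧
      ¬(B ∩ R.core ⊆ F) := by
    intro E hE F hF
    constructor
    · intro h
      have h0 : Ts.ν ℓ (A ∩ R.core) = 0 := measure_mono_null h (Ts.measure_countable hℓ hE)
      rw [Measure.restrict_eq_zero.2 h0, Measure.zero_prod, Measure.map_zero] at hφ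
      exact hR.ne' (Measure.restrict_eq_zero.1 hφ.symm)
    · intro h
      have h0 : Tu.ν m (B ∩ R.core) = 0 := measure_mono_null h (Tu.measure_countable hm hF)
      rw [Measure.restrict_eq_zero.2 h0, Measure.prod_zero, Measure.map_zero] at hφ
      exact hR.ne' (Measure.restrict_eq_zero.1 hφ.symm)
  constructor
  · intro h
    refine (hpos ∅ countable_empty (⋃ A' ∈ R.fibs, (B ∩ A')) (h.biUnion fun A' hA' => ?_)).2 ?_
    · refine Set.Subsingleton.countable fun p hp q hq => ?_
      exact (R.inter_unique A' hA' B hB).unique hp.symm hq.symm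
    · rintro p ⟨hpB, hp, -⟩
      rw [← R.fibs_cover] at hp
      obtain ⟨A', hA', hpA'⟩ := hp
      exact mem_biUnion hA' ⟨hpB, hpA'⟩
  · intro h
    refine (hpos (⋃ B' ∈ R.fibu, (A ∩ B')) (h.biUnion fun B' hB' => ?_) ∅ countable_empty).1 ?_
    · refine Set.Subsingleton.countable fun p hp q hq => ?_
      exact (R.inter_unique A hA B' hB').unique hp hq
    · rintro p ⟨hpA, -, hp⟩
      rw [← R.fibu_cover] at hp
      obtain ⟨B', hB', hpB'⟩ := hp
      exact mem_biUnion hB' ⟨hpA, hpB'⟩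

theorem nontrivial_fibs (R : Tartan Ts Tu) (h : R.fibu.Nontrivial) {A : Set M} (hA : A ∈ R.fibs) :
    A.Nontrivial := by
  obtain ⟨B, hB, B', hB', hne⟩ := h
  obtain ⟨p, hp, -⟩ := R.inter_unique A hA B hB
  obtain ⟨q, hq, -⟩ := R.inter_unique A hA B' hB'
  refine ⟨p, hp.1, q, hq.1, ?_⟩
  rintro rfl
  exact disjoint_left.1 (R.fibu_disjoint hB hB' hne) hp.2 hq.2

theorem nontrivial_fibu (R : Tartan Ts Tu) (h : R.fibs.Nontrivial) {B : Set M} (hB : B ∈ R.fibu) :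
    B.Nontrivial := by
  obtain ⟨A, hA, A', hA', hne⟩ := h
  obtain ⟨p, hp, -⟩ := R.inter_unique A hA B hB
  obtain ⟨q, hq, -⟩ := R.inter_unique A' hA' B hB
  refine ⟨p, hp.2, q, hq.2, ?_⟩
  rintro rfl
  exact disjoint_left.1 (R.fibs_disjoint hA hA' hne) hp.1 hq.1

/-- A compatible tartan of positive measure has infinitely many stable and unstable fibers
avoiding given streamlines. -/
theorem exists_seq_fibers [T2Space M] [BorelSpace M] (R : Tartan Ts Tu) (hc : R.Compatible)
    (hR : 0 < μ R.core) {ℓ m : Set M} (hℓ : ℓ ∈ Ts.lines) (hm : m ∈ Tu.lines) :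
    ∃ A B : ℕ → Set M, Injective A ∧ Injective B ∧ (∀ j, A j ∈ R.fibs ∧ Disjoint (A j) ℓ) ∧
      ∀ i, B i ∈ R.fibu ∧ Disjoint (B i) m := by
  obtain ⟨hs, hu⟩ := R.uncountable_fibers hc hR
  have key : ∀ {T : MeasuredTurbulation μ} {F : Set (Set M)} {n : Set M}, n ∈ T.lines →
      F.PairwiseDisjoint id → ¬F.Countable →
      (∀ A ∈ F, A.Nontrivial ∧ ∃ ℓ' ∈ T.lines, IsArc ℓ' A) →
      ∃ A : ℕ → Set M, Injective A ∧ ∀ j, A j ∈ F ∧ Disjoint (A j) n := by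
    intro T F n hn hF hFc hFa
    have hinf : (F \ {A ∈ F | (A ∩ n).Nonempty}).Infinite := fun hfin =>
      hFc ((hfin.countable.union (T.countable_arcs_meeting hn hF hFa)).mono
        (subset_sdiff_union _ _))
    refine ⟨_, Subtype.val_injective.comp (hinf.natEmbedding _).injective, fun j => ?_⟩
    have hj := (hinf.natEmbedding _ j).2
    exact ⟨hj.1, by
      rw [disjoint_iff_inter_eq_empty, ← not_nonempty_iff_eq_empty]
      exact fun h => hj.2 ⟨hj.1, h⟩⟩
  have nt : ∀ {F : Set (Set M)}, ¬F.Countable → F.Nontrivial := fun h =>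
    not_subsingleton_iff.1 fun h' => h h'.countable
  obtain ⟨A, hA⟩ := key hℓ R.fibs_disjoint hs fun A hA =>
    ⟨R.nontrivial_fibs (nt hu) hA, R.exists_isArc_fibs hA⟩
  obtain ⟨B, hB⟩ := key hm R.fibu_disjoint hu fun B hB =>
    ⟨R.nontrivial_fibu (nt hs) hB, R.exists_isArc_fibu hB⟩
  exact ⟨A, B, hA.1, hB.1, hA.2, hB.2⟩

end Tartan

theorem exists_isOpenEmbedding_of_notMem_manifoldBdry {M : Type} [TopologicalSpace M] {x : M}
    (hx : x ∉ ManifoldBdry M) : ∃ ψ : ℂ → M, IsOpenEmbedding ψ ∧ x ∈ range ψ := by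
  obtain ⟨U, hU, hxU, ⟨e⟩⟩ := not_not.1 hx
  let e' : ℂ ≃ₜ U := Complex.equivRealProdCLM.toHomeomorph.trans e.symm
  refine ⟨Subtype.val ∘ e', hU.isOpenEmbedding_subtypeVal.comp e'.isOpenEmbedding, ?_⟩
  exact ⟨e'.symm ⟨x, hxU⟩, by simp⟩

/-- for measurable pseudo-Anosov turbulations, any stable streamline and any
unstable streamline intersect in a dense subset of `S`. -/
theorem streamline_intersection_dense
    {S : Type} [TopologicalSpace S] [T2Space S] [CompactSpace S]
    [ChartedSpace (EuclideanHalfSpace 2) S] [MeasurableSpace S] [BorelSpace S]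
    (μ : Measure S) [IsProbabilityMeasure μ] (hμ : IsOUMeasure μ)
    (Ts Tu : MeasuredTurbulation μ) (hmpa : MPATurbulations Ts Tu)
    (ℓs : Set S) (hℓs : ℓs ∈ Ts.lines) (ℓu : Set S) (hℓu : ℓu ∈ Tu.lines) :
    Dense (ℓs ∩ ℓu) := by
  rw [dense_iff_inter_open]
  intro O hO hOne
  by_contra hemp
  rw [not_nonempty_iff_eq_empty] at hemp
  obtain ⟨-, -, -, ⟨-, hfull⟩, hds, hdu⟩ := hmpa
  obtain ⟨x, hxO, hxb⟩ : ∃ x ∈ O, x ∉ ManifoldBdry S := by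
    by_contra! h
    exact (hμ.openPos O hO hOne).ne' (measure_mono_null h hμ.boundaryNull)
  obtain ⟨ψ, hψ, w, rfl⟩ := exists_isOpenEmbedding_of_notMem_manifoldBdry hxb
  obtain ⟨r, hr, hball⟩ := Metric.isOpen_iff.1 (hO.preimage hψ.continuous) w hxO
  obtain ⟨R, hRc, hR, hRB⟩ := hfull (ψ '' Metric.ball w r) (hψ.isOpenMap _ Metric.isOpen_ball)
    ⟨_, mem_image_of_mem ψ (Metric.mem_ball_self hr)⟩
  obtain ⟨A, B, hAi, hBi, hA, hB⟩ := R.exists_seq_fibers hRc hR hℓs hℓu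
  have hAb : ∀ j, A j ⊆ ψ '' Metric.ball w r := fun j =>
    (subset_sUnion_of_mem (hA j).1).trans (R.fibs_cover.subset.trans (subset_union_left.trans hRB))
  have hBb : ∀ i, B i ⊆ ψ '' Metric.ball w r := fun i =>
    (subset_sUnion_of_mem (hB i).1).trans (R.fibu_cover.subset.trans (subset_union_right.trans hRB))
  have hpre : ∀ {E : Set S}, E ⊆ ψ '' Metric.ball w r → ψ ⁻¹' E ⊆ Metric.ball w r := fun h =>
    (preimage_mono h).trans (preimage_image_eq _ hψ.injective).subset
  obtain ⟨G, g, h, hGS, hGU⟩ := R.exists_grid (fun j => (hA j).1) (fun i => (hB i).1) hAi hBi hψ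
    (fun j => (hAb j).trans (image_subset_range _ _))
    fun i => (hBb i).trans (image_subset_range _ _)
  obtain ⟨fs, hfs, -, hfsr⟩ := Ts.lines_immersed ℓs hℓs
  obtain ⟨fu, hfu, -, hfur⟩ := Tu.lines_immersed ℓu hℓu
  refine G.false_of_dense hψ hfs (by rw [DenseRange, hfsr]; exact hds ℓs hℓs)
    hfu (by rw [DenseRange, hfur]; exact hdu ℓu hℓu)
    (fun j a b => ?_) (fun i a b => ?_) Metric.isBounded_ball (isPathConnected_compl_ball w r)
    (fun j a b => (hGS j a b).trans (hpre (hAb _))) (fun i a b => (hGU i a b).trans (hpre (hBb _)))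
    ?_
  · rw [hfsr]
    exact ((hA (h j)).2.preimage ψ).mono_left (hGS j a b)
  · rw [hfur]
    exact ((hB (g i)).2.preimage ψ).mono_left (hGU i a b)
  · rw [hfsr, hfur, disjoint_left]
    rintro y ⟨hy, hyb⟩ ⟨hy', -⟩
    exact hemp.subset ⟨hball hyb, hy, hy'⟩


end
end

section
/- Let F : Σ → Σ be a measurable pseudo-Anosov map, φ : Σ → ℝ be continuous, and R be a positive measure compatible tartan. Then there is a constant c ∈ ℝ such that φ⁺(x) = φ⁻(x) = c for μ-almost every x ∈ R^⋔. -/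
open MeasureTheory Set Function Topology Filter
open scoped ENNReal

noncomputable section

variable {S : Type} [TopologicalSpace S] [MeasurableSpace S]

/-- The running maxima of the Birkhoff sums of `f` along `T`, of lengths `1, …, n + 1`. -/
def birkhoffMax {α : Type*} (T : α → α) (f : α → ℝ) : ℕ → α → ℝ
  | 0 => f
  | n + 1 => fun x => f x + max 0 (birkhoffMax T f n (T x))

section Birkhoff

variable {α : Type*} {T : α → α} {f : α → ℝ}

lemma le_birkhoffMax (n : ℕ) (x : α) : f x ≤ birkhoffMax T f n x := by
  cases n with
  | zero => exact le_rfl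
  | succ n => simp [birkhoffMax]

lemma birkhoffMax_mono (x : α) : Monotone fun n => birkhoffMax T f n x := by
  refine monotone_nat_of_le_succ fun n => ?_
  induction n generalizing x with
  | zero => exact le_birkhoffMax 1 x
  | succ n ih =>
    simp only [birkhoffMax]
    have := ih (T x)
    gcongr
    exact this

lemma birkhoffSum_succ_le_birkhoffMax (n : ℕ) (x : α) :
    birkhoffSum T f (n + 1) x ≤ birkhoffMax T f n x := by
  induction n generalizing x with
  | zero => simp [birkhoffMax]
  | succ n ih =>
    rw [birkhoffSum_succ']
    simp only [birkhoffMax]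
    gcongr
    exact (ih (T x)).trans (le_max_right _ _)

variable [MeasurableSpace α] {μ : Measure α}

lemma measurable_birkhoffMax (hT : Measurable T) (hf : Measurable f) (n : ℕ) :
    Measurable (birkhoffMax T f n) := by
  induction n with
  | zero => exact hf
  | succ n ih => exact hf.add (measurable_const.max (ih.comp hT))

lemma integrable_birkhoffMax (hT : MeasurePreserving T μ μ) (hf : Integrable f μ) (n : ℕ) :
    Integrable (birkhoffMax T f n) μ := by
  induction n with
  | zero => exact hf
  | succ n ih =>
    have h := (hT.integrable_comp_of_integrable ih).pos_part
    refine hf.add (h.congr (Eventually.of_forall fun x => ?_))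
    simp [max_comm]

/-- A form of the maximal ergodic theorem. -/
lemma exists_invariant_setIntegral_nonneg (hT : MeasurePreserving T μ μ) (hfm : Measurable f)
    (hf : Integrable f μ) :
    ∃ A : Set α, MeasurableSet A ∧ T ⁻¹' A = A ∧ 0 ≤ ∫ x in A, f x ∂μ ∧
      ∀ x ∉ A, ∃ C : ℝ, ∀ n, birkhoffSum T f n x ≤ C := by
  have hbdd : ∀ x, (¬ Tendsto (fun n => birkhoffMax T f n x) atTop atTop) →
      ∃ C, ∀ n, birkhoffMax T f n x ≤ C := fun x hx => by
    by_contra! h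
    exact hx (tendsto_atTop_atTop_of_monotone (birkhoffMax_mono x) fun b =>
      (h b).imp fun _ => le_of_lt)
  set A : Set α := {x | Tendsto (fun n => birkhoffMax T f n x) atTop atTop} with hA
  have hAm : MeasurableSet A :=
    measurableSet_tendsto _ (fun n => measurable_birkhoffMax hT.measurable hfm n)
  have hAT : T ⁻¹' A = A := by
    ext x
    simp only [hA, mem_preimage, mem_ofPred_eq]
    constructor
    · intro h
      rw [← tendsto_add_atTop_iff_nat 1]
      refine tendsto_atTop_mono (fun n => ?_) (tendsto_atTop_add_const_left _ (f x) h)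
      simp [birkhoffMax]
    · intro h
      by_contra h'
      obtain ⟨C, hC⟩ := hbdd _ h'
      obtain ⟨n, hn⟩ := (((tendsto_add_atTop_iff_nat 1).2 h).eventually_gt_atTop
        (f x + max 0 C)).exists
      simp only [birkhoffMax] at hn
      have := max_le_max_left 0 (hC n)
      linarith
  refine ⟨A, hAm, hAT, ?_, fun x hx => ?_⟩
  · have hMi := fun n => integrable_birkhoffMax hT hf n
    have hTA : ∀ g : α → ℝ, Integrable g μ → ∫ x in A, g (T x) ∂μ = ∫ x in A, g x ∂μ := by
      intro g hg
      have hr : MeasurePreserving T (μ.restrict A) (μ.restrict A) := by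
        simpa only [hAT] using hT.restrict_preimage hAm
      have hg' : AEStronglyMeasurable g (Measure.map T (μ.restrict A)) := by
        rw [hr.map_eq]; exact hg.aestronglyMeasurable.restrict
      rw [← integral_map hr.measurable.aemeasurable hg', hr.map_eq]
    have hlim : Tendsto (fun n => ∫ x in A, (birkhoffMax T f (n + 1) x - birkhoffMax T f n (T x)) ∂μ)
        atTop (𝓝 (∫ x in A, f x ∂μ)) := by
      refine tendsto_integral_of_dominated_convergence (fun x => |f x| + |f (T x)|)
        (fun n => ((hMi (n + 1)).sub
          (hT.integrable_comp_of_integrable (hMi n))).aestronglyMeasurable.restrict)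
        (hf.abs.add (hT.integrable_comp_of_integrable hf).abs).restrict ?_ ?_
      · intro n
        refine Eventually.of_forall fun x => ?_
        have h1 := le_birkhoffMax (T := T) (f := f) n (T x)
        rw [Real.norm_eq_abs]
        simp only [birkhoffMax]
        have := neg_abs_le (f x)
        have := le_abs_self (f x)
        have := neg_abs_le (f (T x))
        have := abs_nonneg (f (T x))
        rw [abs_le]
        rcases max_cases 0 (birkhoffMax T f n (T x)) with ⟨h, h'⟩ | ⟨h, h'⟩ <;> rw [h] <;>
          constructor <;> linarith
      · filter_upwards [ae_restrict_mem hAm] with x hx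
        have hx' : x ∈ T ⁻¹' A := by rwa [hAT]
        refine tendsto_const_nhds.congr' ?_
        filter_upwards [(show Tendsto (fun n => birkhoffMax T f n (T x)) atTop atTop from
          hx').eventually_ge_atTop 0] with n hn
        simp [birkhoffMax, hn]
    refine ge_of_tendsto' hlim fun n => ?_
    have hMT : Integrable (fun x => birkhoffMax T f n (T x)) (μ.restrict A) :=
      (hT.integrable_comp_of_integrable (hMi n)).restrict
    rw [integral_sub (hMi _).restrict hMT, hTA _ (hMi n), sub_nonneg]
    exact integral_mono (hMi _).restrict (hMi _).restrict fun x => birkhoffMax_mono x n.le_succ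
  · obtain ⟨C, hC⟩ := hbdd x hx
    refine ⟨max 0 C, fun n => ?_⟩
    cases n with
    | zero => simp
    | succ n => exact (birkhoffSum_succ_le_birkhoffMax n x).trans ((hC n).trans (le_max_right _ _))

variable [IsProbabilityMeasure μ]

lemma ae_birkhoffSum_le (hT : MeasurePreserving T μ μ) (hfm : Measurable f)
    (hf : Integrable f μ) {ε : ℝ} (hε : 0 < ε) :
    ∀ᵐ x ∂μ, ∃ C : ℝ, ∀ n : ℕ,
      birkhoffSum T f n x ≤ n * ((μ[f | MeasurableSpace.invariants T]) x + ε) + C := by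
  have hle := MeasurableSpace.invariants_le T
  set E := μ[f | MeasurableSpace.invariants T] with hE
  have hEm : Measurable[MeasurableSpace.invariants T] E := stronglyMeasurable_condExp.measurable
  have hET : ∀ x, E (T x) = E x := congrFun (MeasurableSpace.comp_eq_of_measurable_invariants hEm)
  have hEi : Integrable E μ := integrable_condExp
  obtain ⟨A, hAm, hAT, hA0, hAC⟩ := exists_invariant_setIntegral_nonneg (f := fun x => f x - E x - ε)
    hT ((hfm.sub (hEm.mono hle le_rfl)).sub_const ε) ((hf.sub hEi).sub (integrable_const ε))
  have hA : μ A = 0 := by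
    have h1 : ∫ x in A, E x ∂μ = ∫ x in A, f x ∂μ :=
      setIntegral_condExp hle hf (MeasurableSpace.measurableSet_invariants.2 ⟨hAm, hAT⟩)
    have hfE : Integrable (fun x => f x - E x) (μ.restrict A) := (hf.sub hEi).restrict
    rw [integral_sub hfE (integrable_const ε),
      integral_sub hf.restrict hEi.restrict, h1] at hA0
    simp only [sub_self, integral_const, measureReal_restrict_apply_univ, smul_eq_mul] at hA0
    have : μ.real A ≤ 0 := by
      by_contra! h
      nlinarith
    exact (measureReal_eq_zero_iff).1 (le_antisymm this measureReal_nonneg)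
  filter_upwards [measure_eq_zero_iff_ae_notMem.1 hA] with x hx
  obtain ⟨C, hC⟩ := hAC x hx
  refine ⟨C, fun n => ?_⟩
  have hEn : ∀ i, E (T^[i] x) = E x := fun i => by
    induction i with
    | zero => rfl
    | succ i ih => rw [Function.iterate_succ_apply', hET, ih]
  have := hC n
  simp only [birkhoffSum, Finset.sum_sub_distrib, hEn, Finset.sum_const, Finset.card_range,
    nsmul_eq_mul] at this ⊢
  linarith

/-- **Birkhoff's pointwise ergodic theorem.** -/
theorem ae_tendsto_birkhoffSum_div (hT : MeasurePreserving T μ μ) (hfm : Measurable f)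
    (hf : Integrable f μ) :
    ∀ᵐ x ∂μ, Tendsto (fun n : ℕ => (n : ℝ)⁻¹ * birkhoffSum T f n x) atTop
      (𝓝 ((μ[f | MeasurableSpace.invariants T]) x)) := by
  have hup : ∀ᵐ x ∂μ, ∀ k : ℕ, ∃ C : ℝ, ∀ n : ℕ, birkhoffSum T f n x ≤
      n * ((μ[f | MeasurableSpace.invariants T]) x + 1 / ((k : ℝ) + 1)) + C :=
    ae_all_iff.2 fun k => ae_birkhoffSum_le hT hfm hf Nat.one_div_pos_of_nat
  have hlow : ∀ᵐ x ∂μ, ∀ k : ℕ, ∃ C : ℝ, ∀ n : ℕ, birkhoffSum T (-f) n x ≤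
      n * ((μ[-f | MeasurableSpace.invariants T]) x + 1 / ((k : ℝ) + 1)) + C :=
    ae_all_iff.2 fun k => ae_birkhoffSum_le hT hfm.neg hf.neg Nat.one_div_pos_of_nat
  filter_upwards [hup, hlow, condExp_neg f (MeasurableSpace.invariants T) (μ := μ)]
    with x hu hl hneg
  rw [hneg] at hl
  simp only [birkhoffSum, Pi.neg_apply, Finset.sum_neg_distrib] at hl hu ⊢
  rw [Metric.tendsto_atTop]
  intro ε hε
  obtain ⟨k, hk⟩ := exists_nat_one_div_lt (half_pos hε)
  obtain ⟨C, hC⟩ := hu k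
  obtain ⟨C', hC'⟩ := hl k
  obtain ⟨N, hN⟩ := exists_nat_gt (max C C' / (ε / 2))
  refine ⟨N + 1, fun n hn => ?_⟩
  have hn0 : (0 : ℝ) < n := by exact_mod_cast (Nat.succ_pos N).trans_le hn
  have hNn : (N : ℝ) < n := by exact_mod_cast hn
  have hmax : max C C' < n * (ε / 2) := (div_lt_iff₀ (half_pos hε)).1 (hN.trans hNn)
  have h1 := (le_max_left C C').trans_lt hmax
  have h2 := (le_max_right C C').trans_lt hmax
  have h3 := hC n
  have h4 := hC' n
  have h5 := mul_lt_mul_of_pos_left hk hn0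
  rw [Real.dist_eq, abs_lt, inv_mul_eq_div]
  constructor
  · rw [lt_sub_iff_add_lt, lt_div_iff₀ hn0]
    nlinarith
  · rw [sub_lt_iff_lt_add, div_lt_iff₀ hn0]
    nlinarith

end Birkhoff

section Streamlines

lemma IsArcIn.image {X : Type} [TopologicalSpace X] {ℓ A : Set X} {x y : X}
    (h : IsArcIn ℓ A x y) (G : X ≃ₜ X) :
    IsArcIn (⇑G '' ℓ) (⇑G '' A) (G x) (G y) := by
  obtain ⟨f, hf, hinj, rfl, a, b, hab, rfl, rfl, rfl⟩ := h
  exact ⟨G ∘ f, G.continuous.comp hf, G.injective.comp hinj, range_comp _ _, a, b, hab, rfl, rfl,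
    (image_comp _ _ _).symm⟩

variable {μ : Measure S}

/-- Points on a common streamline which is contracted by the iterates of `G` are asymptotic. -/
lemma MeasuredTurbulation.tendsto_sub_of_contract [CompactSpace S]
    [TopologicalSpace.MetrizableSpace S] {T : MeasuredTurbulation μ} (hT : T.Tame) (G : S ≃ₜ S)
    {q : ℝ≥0∞} (hq : q < 1)
    (hG : ∀ ℓ ∈ T.lines, ⇑G '' ℓ ∈ T.lines → ∀ A x y, IsArcIn ℓ A x y →
      T.ν (⇑G '' ℓ) (⇑G '' A) = q * T.ν ℓ A)
    {ℓ : Set S} (hℓ : ∀ n, (⇑G)^[n] '' ℓ ∈ T.lines) {φ : S → ℝ} (hφ : Continuous φ)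
    {x y : S} (hx : x ∈ ℓ) (hy : y ∈ ℓ) :
    Tendsto (fun n => φ ((⇑G)^[n] x) - φ ((⇑G)^[n] y)) atTop (𝓝 0) := by
  have hℓ0 : ℓ ∈ T.lines := by simpa using hℓ 0
  obtain ⟨f, hf, hinj, rfl⟩ := T.lines_immersed ℓ hℓ0
  obtain ⟨s, rfl⟩ := hx
  obtain ⟨t, rfl⟩ := hy
  wlog hst : s ≤ t generalizing s t
  · simpa using (this t s (le_of_not_ge hst)).neg
  have harc : IsArcIn (range f) (f '' Icc s t) (f s) (f t) :=
    ⟨f, hf, hinj, rfl, s, t, hst, rfl, rfl, rfl⟩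
  have hiter : ∀ n, IsArcIn ((⇑G)^[n] '' range f) ((⇑G)^[n] '' (f '' Icc s t))
      ((⇑G)^[n] (f s)) ((⇑G)^[n] (f t)) ∧
      T.ν ((⇑G)^[n] '' range f) ((⇑G)^[n] '' (f '' Icc s t)) =
        q ^ n * T.ν (range f) (f '' Icc s t) := by
    intro n
    induction n with
    | zero => simpa using harc
    | succ n ih =>
      have hsucc : ∀ s : Set S, (⇑G)^[n + 1] '' s = ⇑G '' ((⇑G)^[n] '' s) := fun s => by
        rw [Function.iterate_succ', image_comp]
      have hn := hℓ (n + 1)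
      rw [hsucc] at hn
      rw [hsucc, hsucc, Function.iterate_succ_apply', Function.iterate_succ_apply']
      exact ⟨ih.1.image G, by rw [hG _ (hℓ n) hn _ _ _ ih.1, ih.2, pow_succ', mul_assoc]⟩
  have hν : Tendsto (fun n => q ^ n * T.ν (range f) (f '' Icc s t)) atTop (𝓝 0) := by
    simpa using ENNReal.Tendsto.mul_const (ENNReal.tendsto_pow_atTop_nhds_zero_of_lt_one hq)
      (Or.inr (T.ν_arc_finite _ hℓ0 _ _ _ harc).ne)
  let _ : MetricSpace S := TopologicalSpace.metrizableSpaceMetric S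
  have hd : IsCompatibleMetric S dist := by
    refine ⟨dist_comm, fun _ _ => dist_eq_zero, dist_triangle, fun u => ?_⟩
    simp only [Metric.isOpen_iff, subset_def, Metric.mem_ball, dist_comm]
  have hu := CompactSpace.uniformContinuous_of_continuous hφ
  rw [Metric.uniformContinuous_iff] at hu
  rw [Metric.tendsto_atTop]
  intro ε hε
  obtain ⟨δ, hδ, hu⟩ := hu ε hε
  obtain ⟨η, hη, hT⟩ := hT dist hd δ hδ
  obtain ⟨N, hN⟩ := eventually_atTop.1 (hν.eventually_lt_const (ENNReal.ofReal_pos.2 hη))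
  refine ⟨N, fun n hn => ?_⟩
  rw [Real.dist_eq, sub_zero, ← Real.dist_eq]
  exact hu (hT _ (hℓ n) _ _ _ (hiter n).1 ((hiter n).2 ▸ hN n hn))

lemma MeasuredTurbulation.tendsto_birkhoffFwd_of_contract [CompactSpace S]
    [TopologicalSpace.MetrizableSpace S] {T : MeasuredTurbulation μ} (hT : T.Tame) (G : S ≃ₜ S)
    {q : ℝ≥0∞} (hq : q < 1)
    (hG : ∀ ℓ ∈ T.lines, ⇑G '' ℓ ∈ T.lines → ∀ A x y, IsArcIn ℓ A x y →
      T.ν (⇑G '' ℓ) (⇑G '' A) = q * T.ν ℓ A)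
    {ℓ : Set S} (hℓ : ∀ n, (⇑G)^[n] '' ℓ ∈ T.lines) {φ : S → ℝ} (hφ : Continuous φ)
    {x y : S} (hx : x ∈ ℓ) (hy : y ∈ ℓ) {c : ℝ} (hc : Tendsto (birkhoffFwd G φ x) atTop (𝓝 c)) :
    Tendsto (birkhoffFwd G φ y) atTop (𝓝 c) := by
  have h := hc.add (T.tendsto_sub_of_contract hT G hq hG hℓ hφ hy hx).cesaro
  rw [add_zero] at h
  refine h.congr fun n => ?_
  simp only [birkhoffFwd, Finset.sum_sub_distrib]
  ring

/-- If the backward orbit of a point of a streamline stays in the domain of an invariant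
turbulation, then all the preimages of the streamline are streamlines. -/
lemma MeasuredTurbulation.symm_iterate_image_mem {T : MeasuredTurbulation μ} {F : S ≃ₜ S}
    (hF : ∀ ℓ ∈ T.lines, ⇑F '' ℓ ∈ T.lines) {ℓ : Set S} (hℓ : ℓ ∈ T.lines) {x : S} (hx : x ∈ ℓ)
    (hdom : ∀ n, (⇑F.symm)^[n] x ∈ ⋃₀ T.lines) (n : ℕ) : (⇑F.symm)^[n] '' ℓ ∈ T.lines := by
  induction n with
  | zero => simpa
  | succ n ih =>
    obtain ⟨ℓ', hℓ', hx'⟩ := hdom (n + 1)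
    have heq : ⇑F '' ℓ' = (⇑F.symm)^[n] '' ℓ := by
      refine T.lines_disjoint.elim_set (hF _ hℓ') ih ((⇑F.symm)^[n] x) ?_ (mem_image_of_mem _ hx)
      refine ⟨_, hx', ?_⟩
      rw [Function.iterate_succ_apply', F.apply_symm_apply]
    rw [Function.iterate_succ', image_comp, ← heq, ← image_comp]
    simpa using hℓ'

lemma IsMPA.symm_contract {F : S ≃ₜ S} {Ts Tu : MeasuredTurbulation μ} {lam : ℝ}
    (hF : IsMPA μ F Ts Tu lam) {ℓ A : Set S} (hℓ : ⇑F.symm '' ℓ ∈ Tu.lines) {x y : S}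
    (hA : IsArcIn ℓ A x y) :
    Tu.ν (⇑F.symm '' ℓ) (⇑F.symm '' A) = (ENNReal.ofReal lam)⁻¹ * Tu.ν ℓ A := by
  have h := hF.unstable_expand _ hℓ _ _ _ (hA.image F.symm)
  simp only [← image_comp, F.self_comp_symm, image_id] at h
  rw [h, ← mul_assoc, ENNReal.inv_mul_cancel _ ENNReal.ofReal_ne_top, one_mul]
  exact (ENNReal.ofReal_pos.2 (zero_lt_one.trans hF.one_lt_lam)).ne'

lemma invariants_symm (F : S ≃ₜ S) :
    MeasurableSpace.invariants ⇑F.symm = MeasurableSpace.invariants ⇑F := by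
  ext s
  simp only [MeasurableSpace.measurableSet_invariants]
  refine and_congr_right fun _ => ?_
  constructor <;> intro h
  · simpa [← preimage_comp] using congrArg (⇑F ⁻¹' ·) h.symm
  · simpa [← preimage_comp] using congrArg (⇑F.symm ⁻¹' ·) h.symm

/-- The forward and backward Birkhoff averages of a continuous function agree almost everywhere. -/
lemma ae_mem_ZSet [CompactSpace S] [BorelSpace S] [IsProbabilityMeasure μ] {F : S ≃ₜ S}
    (hF : MeasurePreserving F μ μ) {φ : S → ℝ} (hφ : Continuous φ) : ∀ᵐ x ∂μ, x ∈ ZSet F φ := by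
  have hi : Integrable φ μ := by
    obtain ⟨C, hC⟩ := isCompact_univ.exists_bound_of_continuousOn hφ.continuousOn
    exact Integrable.of_bound hφ.measurable.aestronglyMeasurable C
      (Eventually.of_forall fun x => hC x (mem_univ x))
  have hF' : MeasurePreserving F.symm μ μ := hF.symm F.toMeasurableEquiv
  have h := ae_tendsto_birkhoffSum_div hF' hφ.measurable hi
  rw [invariants_symm] at h
  filter_upwards [ae_tendsto_birkhoffSum_div hF hφ.measurable hi, h] with x h1 h2
  exact ⟨_, h1, h2⟩

end Streamlines

namespace Tartan

variable {μ : Measure S} {Ts Tu : MeasuredTurbulation μ}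

lemma exists_line_of_mem_fibs (R : Tartan Ts Tu) {A : Set S} (hA : A ∈ R.fibs) :
    ∃ ℓ ∈ Ts.lines, A ⊆ ℓ ∧ IsCompact A := by
  obtain ⟨_, _, h, -⟩ := R.oriented
  obtain ⟨ℓ, hℓ, f, hf, -, rfl, a, b, -, rfl, -⟩ := h A hA
  exact ⟨_, hℓ, image_subset_range _ _, isCompact_Icc.image hf⟩

lemma exists_line_of_mem_fibu (R : Tartan Ts Tu) {B : Set S} (hB : B ∈ R.fibu) :
    ∃ ℓ ∈ Tu.lines, B ⊆ ℓ ∧ IsCompact B := by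
  obtain ⟨_, _, -, h, -⟩ := R.oriented
  obtain ⟨ℓ, hℓ, f, hf, -, rfl, a, b, -, rfl, -⟩ := h B hB
  exact ⟨_, hℓ, image_subset_range _ _, isCompact_Icc.image hf⟩

lemma exists_fibs_of_mem_core (R : Tartan Ts Tu) {x : S} (hx : x ∈ R.core) :
    ∃ A ∈ R.fibs, x ∈ A := by
  have := hx.1
  rwa [← R.fibs_cover] at this

lemma exists_fibu_of_mem_core (R : Tartan Ts Tu) {x : S} (hx : x ∈ R.core) :
    ∃ B ∈ R.fibu, x ∈ B := by
  have := hx.2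
  rwa [← R.fibu_cover] at this

end Tartan

/-- on a positive measure compatible tartan, the Birkhoff averages
`φ⁺ = φ⁻` are almost everywhere equal to a constant. -/
theorem birkhoff_constant_on_tartan
    {S : Type} [TopologicalSpace S] [T2Space S] [CompactSpace S]
    [ChartedSpace (EuclideanHalfSpace 2) S] [MeasurableSpace S] [BorelSpace S]
    (μ : Measure S) [IsProbabilityMeasure μ] (hμ : IsOUMeasure μ)
    (Ts Tu : MeasuredTurbulation μ) (F : S ≃ₜ S) (lam : ℝ)
    (hF : IsMPA μ F Ts Tu lam) (φ : S → ℝ) (hφ : Continuous φ)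
    (R : Tartan Ts Tu) (hcomp : R.Compatible) (hpos : 0 < μ R.core) :
    ∃ c : ℝ, ∀ᵐ x ∂(μ.restrict R.core),
      Tendsto (birkhoffFwd F φ x) atTop (𝓝 c) ∧
      Tendsto (birkhoffBwd F φ x) atTop (𝓝 c) := by
  have : SecondCountableTopology (EuclideanHalfSpace 2) :=
    TopologicalSpace.Subtype.secondCountableTopology _
  have : SecondCountableTopology S :=
    ChartedSpace.secondCountable_of_sigmaCompact (EuclideanHalfSpace 2) S
  have : TopologicalSpace.MetrizableSpace S := TopologicalSpace.metrizableSpace_of_t3_secondCountable S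
  obtain ⟨-, hsTame, huTame, -⟩ := hF.turbulations
  have hq : (ENNReal.ofReal lam)⁻¹ < 1 := by
    rw [ENNReal.inv_lt_one, ENNReal.one_lt_ofReal]
    exact hF.one_lt_lam
  have hstable : ∀ ℓ ∈ Ts.lines, ∀ x ∈ ℓ, ∀ y ∈ ℓ, ∀ c, Tendsto (birkhoffFwd F φ x) atTop (𝓝 c) →
      Tendsto (birkhoffFwd F φ y) atTop (𝓝 c) := by
    intro ℓ hℓ x hx y hy c
    refine Ts.tendsto_birkhoffFwd_of_contract hsTame F hq
      (fun ℓ hℓ _ A x y => hF.stable_contract ℓ hℓ A x y) (fun n => ?_) hφ hx hy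
    induction n with
    | zero => simpa
    | succ n ih =>
      rw [Function.iterate_succ', image_comp]
      exact hF.stable_image _ ih
  have hunstable : ∀ ℓ ∈ Tu.lines, ∀ x ∈ ℓ, ∀ y ∈ ℓ,
      (∀ n, (⇑F.symm)^[n] x ∈ ⋃₀ Tu.lines) → ∀ c, Tendsto (birkhoffBwd F φ x) atTop (𝓝 c) →
      Tendsto (birkhoffBwd F φ y) atTop (𝓝 c) := by
    intro ℓ hℓ x hx y hy hdom c
    exact Tu.tendsto_birkhoffFwd_of_contract huTame F.symm hq
      (fun ℓ _ hℓ' A x y hA => hF.symm_contract hℓ' hA)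
      (Tu.symm_iterate_image_mem hF.unstable_image hℓ hx hdom) hφ hx hy
  have hdom : ∀ᵐ x ∂μ, ∀ n, (⇑F.symm)^[n] x ∈ ⋃₀ Tu.lines := by
    refine ae_all_iff.2 fun n => ?_
    have hF' : MeasurePreserving F.symm μ μ := hF.measurePreserving.symm F.toMeasurableEquiv
    exact (hF'.iterate n).quasiMeasurePreserving.ae
      ((prob_compl_eq_zero_iff Tu.domain_borel).2 Tu.domain_full)
  have hgood := (ae_mem_ZSet hF.measurePreserving hφ).and hdom
  have hcoreM : MeasurableSet R.core := R.borel_s.inter R.borel_u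
  obtain ⟨z, hz⟩ := nonempty_of_measure_ne_zero hpos.ne'
  obtain ⟨𝔰, h𝔰, -⟩ := R.exists_fibs_of_mem_core hz
  obtain ⟨𝔲, h𝔲, -⟩ := R.exists_fibu_of_mem_core hz
  obtain ⟨ℓs, hℓs, h𝔰ℓ, h𝔰c⟩ := R.exists_line_of_mem_fibs h𝔰
  obtain ⟨ℓu, hℓu, h𝔲ℓ, h𝔲c⟩ := R.exists_line_of_mem_fibu h𝔲
  obtain ⟨ψ, hψ, -, -, hψm, -, hmap⟩ := hcomp 𝔰 h𝔰 𝔲 h𝔲 ℓs hℓs h𝔰ℓ ℓu hℓu h𝔲ℓ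
  obtain ⟨L, hL, hLs, hLu⟩ := R.bounded
  have hs_mem := ae_restrict_mem (μ := Ts.ν ℓs) (h𝔰c.isClosed.measurableSet.inter hcoreM)
  have hu_mem := ae_restrict_mem (μ := Tu.ν ℓu) (h𝔲c.isClosed.measurableSet.inter hcoreM)
  have : IsFiniteMeasure ((Ts.ν ℓs).restrict (𝔰 ∩ R.core)) :=
    isFiniteMeasure_restrict.2
      (((measure_mono inter_subset_left).trans (hLs 𝔰 h𝔰 ℓs hℓs h𝔰ℓ)).trans_lt hL).ne
  have : IsFiniteMeasure ((Tu.ν ℓu).restrict (𝔲 ∩ R.core)) :=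
    isFiniteMeasure_restrict.2
      (((measure_mono inter_subset_left).trans (hLu 𝔲 h𝔲 ℓu hℓu h𝔲ℓ)).trans_lt hL).ne
  set νs := (Ts.ν ℓs).restrict (𝔰 ∩ R.core)
  set νu := (Tu.ν ℓu).restrict (𝔲 ∩ R.core)
  have hne : νs.prod νu ≠ 0 := by
    intro h0
    rw [h0, Measure.map_zero] at hmap
    exact hpos.ne' (Measure.restrict_eq_zero.1 hmap.symm)
  have : (ae νs).NeBot := ae_neBot.2 fun h => hne (by rw [h, Measure.zero_prod])
  have : (ae νu).NeBot := ae_neBot.2 fun h => hne (by rw [h, Measure.prod_zero])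
  have hψgood : ∀ᵐ p ∂νs.prod νu,
      ψ p ∈ ZSet F φ ∧ ∀ n, (⇑F.symm)^[n] (ψ p) ∈ ⋃₀ Tu.lines := by
    have h : ∀ᵐ z ∂(νs.prod νu).map ψ, z ∈ ZSet F φ ∧ ∀ n, (⇑F.symm)^[n] z ∈ ⋃₀ Tu.lines := by
      rw [hmap]
      exact ae_restrict_of_ae hgood
    exact ae_of_ae_map hψm.aemeasurable h
  obtain ⟨x₀, hx₀, hx₀_good⟩ := (hs_mem.and (Measure.ae_ae_of_ae_prod hψgood)).exists
  obtain ⟨y₀, hy₀, ⟨c, -, hcb⟩, hy₀_dom⟩ := (hu_mem.and hx₀_good).exists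
  have hfwd : ∀ᵐ y ∂νu, Tendsto (birkhoffFwd F φ (ψ (x₀, y))) atTop (𝓝 c) := by
    filter_upwards [hx₀_good, hu_mem] with y ⟨⟨c', hc'f, hc'b⟩, _⟩ hy
    obtain ⟨B, hB, hxB⟩ := R.exists_fibu_of_mem_core hx₀.2
    obtain ⟨A, hA, hyA⟩ := R.exists_fibs_of_mem_core hy.2
    obtain ⟨A₀, hA₀, hyA₀⟩ := R.exists_fibs_of_mem_core hy₀.2
    obtain ⟨ℓ, hℓ, hBℓ, -⟩ := R.exists_line_of_mem_fibu hB
    have := hunstable ℓ hℓ _ (hBℓ (hψ x₀ hx₀ y₀ hy₀ B hB hxB A₀ hA₀ hyA₀).1) _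
      (hBℓ (hψ x₀ hx₀ y hy B hB hxB A hA hyA).1) hy₀_dom c hcb
    rwa [tendsto_nhds_unique this hc'b]
  refine ⟨c, ?_⟩
  have hFm : ∀ n, Measurable fun x => birkhoffFwd F φ x n := fun n =>
    measurable_const.mul (Finset.measurable_fun_sum _ fun i _ =>
      hφ.measurable.comp (F.continuous.measurable.iterate i))
  have hBm : ∀ n, Measurable fun x => birkhoffBwd F φ x n := fun n =>
    measurable_const.mul (Finset.measurable_fun_sum _ fun i _ =>
      hφ.measurable.comp (F.symm.continuous.measurable.iterate i))
  rw [← hmap]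
  refine (ae_map_iff hψm.aemeasurable
    ((measurableSet_tendsto _ hFm).inter (measurableSet_tendsto _ hBm))).2 ?_
  filter_upwards [hψgood, Measure.quasiMeasurePreserving_fst.ae hs_mem,
    Measure.quasiMeasurePreserving_snd.ae hu_mem, Measure.quasiMeasurePreserving_snd.ae hfwd]
    with ⟨x, y⟩ ⟨⟨c', hc'f, hc'b⟩, _⟩ hx hy hfy
  obtain ⟨B, hB, hxB⟩ := R.exists_fibu_of_mem_core hx.2
  obtain ⟨B₀, hB₀, hxB₀⟩ := R.exists_fibu_of_mem_core hx₀.2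
  obtain ⟨A, hA, hyA⟩ := R.exists_fibs_of_mem_core hy.2
  obtain ⟨ℓ, hℓ, hAℓ, -⟩ := R.exists_line_of_mem_fibs hA
  have h := hstable ℓ hℓ _ (hAℓ (hψ x₀ hx₀ y hy B₀ hB₀ hxB₀ A hA hyA).2) _
    (hAℓ (hψ x hx y hy B hB hxB A hA hyA).2) c hfy
  obtain rfl := tendsto_nhds_unique h hc'f
  exact ⟨h, hc'b⟩

end
end
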